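/- arXiv:2409.18363 — 5 statements merged into one kernel-verified Lean document; each statement's English description precedes it below -/
import Mathlib

section
/- Polynomial dichotomy: Let δ > 0 and ε > 0 be reals and let P = (P₁, …, P_d) : ℤ^r → ℤ^d be an integer polynomial map with zero constant term whose components are linearly independent over ℚ. Then there exists a positive integer M = M(δ, ε, P) such that the following holds. If T is an ergodic measure-preserving ℤ^d-action on a probability space (X, μ), A ⊆ X is measurable with μ(A) ≥ δ, σ is the spectral measure of A, and σ(Rat(M)) < μ(A)²ε²/4, then μ(⋃_{n∈ℤ^r} (T^{P(n)})⁻¹A) > 1 − ε. -/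
open MeasureTheory Filter
open scoped symmDiff

/-- A measure-preserving `ℤ^d`-action on `(X, μ)`: a family of measurable maps
`(T v)_{v ∈ ℤ^d}` with `T 0 = id`, `T (v+w) = T v ∘ T w`, each preserving `μ`. -/
def IsMPAction {X : Type} [MeasurableSpace X] (d : ℕ)
    (T : (Fin d → ℤ) → X → X) (μ : Measure X) : Prop :=
  T 0 = id ∧ (∀ v w, T (v + w) = T v ∘ T w) ∧ ∀ v, MeasurePreserving (T v) μ μ

/-- The action is ergodic: every measurable set invariant (up to null sets) under
all the maps `T v` has measure `0` or `1`. -/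
def IsErgodicAction {X : Type} [MeasurableSpace X] (d : ℕ)
    (T : (Fin d → ℤ) → X → X) (μ : Measure X) : Prop :=
  IsMPAction d T μ ∧
    ∀ A : Set X, MeasurableSet A →
      (∀ v, μ ((T v ⁻¹' A) ∆ A) = 0) → μ A = 0 ∨ μ A = 1

/-- `σ` is the spectral measure of the set `A`: a finite Borel measure on the torus
`𝕋^d = (ℝ/ℤ)^d` with `μ(A ∩ (T v)⁻¹ A) = ∫ e(v·α) dσ(α)` for all `v ∈ ℤ^d`. -/
def IsSpectralMeasure {X : Type} [MeasurableSpace X] (d : ℕ)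
    (T : (Fin d → ℤ) → X → X) (μ : Measure X) (A : Set X)
    (σ : Measure (Fin d → AddCircle (1 : ℝ))) : Prop :=
  ∀ v : Fin d → ℤ,
    ((μ (A ∩ T v ⁻¹' A)).toReal : ℂ) =
      ∫ α, (AddCircle.toCircle (∑ i, (v i) • (α i)) : ℂ) ∂σ

/-- `Rat(M)`: the set of nonzero torsion points of `𝕋^d` of order at most `M`. -/
def ratTorsion (d M : ℕ) : Set (Fin d → AddCircle (1 : ℝ)) :=
  {α | α ≠ 0 ∧ ∃ q : ℕ, 1 ≤ q ∧ q ≤ M ∧ q • α = 0}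

/-- The additive character `x ↦ exp (2πix)` of `ℝ`, factored through `ℝ/ℤ`. -/
noncomputable def phase (x : ℝ) : ℂ := (AddCircle.toCircle (x : AddCircle (1 : ℝ)) : ℂ)

lemma phase_add (x y : ℝ) : phase (x + y) = phase x * phase y := by
  simp [phase, AddCircle.toCircle_add]

lemma norm_phase (x : ℝ) : ‖phase x‖ = 1 := Circle.norm_coe _

lemma phase_eq_one_iff (x : ℝ) : phase x = 1 ↔ ∃ z : ℤ, (z : ℝ) = x := by
  have h : phase x = 1 ↔ AddCircle.toCircle (x : AddCircle (1 : ℝ)) =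
      AddCircle.toCircle (0 : AddCircle (1 : ℝ)) := by
    rw [AddCircle.toCircle_zero, ← Circle.coe_eq_one, phase]
  rw [h, (AddCircle.injective_toCircle one_ne_zero).eq_iff, AddCircle.coe_eq_zero_iff]
  simp

lemma phase_intCast (z : ℤ) : phase z = 1 := (phase_eq_one_iff _).2 ⟨z, rfl⟩

lemma phase_sub (x y : ℝ) : phase (x - y) = phase x * (starRingEnd ℂ) (phase y) := by
  have h := phase_add (x - y) y
  rw [sub_add_cancel] at h
  rw [h, mul_assoc, Complex.mul_conj, Complex.normSq_eq_norm_sq, norm_phase]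
  simp

lemma phase_nsmul (x : ℝ) (n : ℕ) : phase (n * x) = phase x ^ n := by
  induction n with
  | zero => simpa using phase_intCast 0
  | succ n ih => rw [pow_succ, ← ih, ← phase_add]; congr 1; push_cast; ring

/-- A quantitative van der Corput inequality for bounded sequences. -/
lemma vanDerCorput (u : ℕ → ℂ) (hu : ∀ n, ‖u n‖ ≤ 1) (H N : ℕ) (κ : ℝ)
    (h : ∀ a < H, ∀ b < H, a ≠ b →
      ‖∑ n ∈ Finset.range N, u (n + a) * (starRingEnd ℂ) (u (n + b))‖ ≤ κ * N)
    (hκ : 0 ≤ κ) :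
    H * ‖∑ n ∈ Finset.range N, u n‖ ≤ 2 * H * H + √(N * (H * N + H * H * (κ * N))) := by
  set S := ∑ n ∈ Finset.range N, u n with hS
  set V : ℕ → ℂ := fun n => ∑ a ∈ Finset.range H, u (n + a) with hV
  have shift : ∀ a, ‖S - ∑ n ∈ Finset.range N, u (n + a)‖ ≤ 2 * a := by
    intro a
    induction a with
    | zero => simp [hS]
    | succ a ih =>
      have e : ∑ n ∈ Finset.range N, u (n + (a + 1)) =
          (∑ n ∈ Finset.range N, u (n + a)) + u (N + a) - u (0 + a) := by
        have h1 := Finset.sum_range_succ (fun n => u (n + a)) N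
        have h2 := Finset.sum_range_succ' (fun n => u (n + a)) N
        rw [h1] at h2
        have h3 : ∀ n, u (n + 1 + a) = u (n + (a + 1)) := fun n => by congr 1; omega
        simp only [h3] at h2
        rw [h2]; ring
      have e2 : S - ∑ n ∈ Finset.range N, u (n + (a + 1)) =
          (S - ∑ n ∈ Finset.range N, u (n + a)) - u (N + a) + u (0 + a) := by rw [e]; ring
      rw [e2]
      calc _ ≤ ‖(S - ∑ n ∈ Finset.range N, u (n + a)) - u (N + a)‖ + ‖u (0 + a)‖ :=
            norm_add_le _ _
        _ ≤ ‖S - ∑ n ∈ Finset.range N, u (n + a)‖ + ‖u (N + a)‖ + ‖u (0 + a)‖ := by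
            gcongr; exact norm_sub_le _ _
        _ ≤ 2 * a + 1 + 1 := by gcongr <;> apply hu
        _ = _ := by push_cast; ring
  have hdiff : ‖(H : ℂ) * S - ∑ n ∈ Finset.range N, V n‖ ≤ 2 * H * H := by
    have e : (H : ℂ) * S - ∑ n ∈ Finset.range N, V n =
        ∑ a ∈ Finset.range H, (S - ∑ n ∈ Finset.range N, u (n + a)) := by
      rw [Finset.sum_sub_distrib, hV, Finset.sum_comm]; simp
    rw [e]
    calc _ ≤ ∑ a ∈ Finset.range H, (2 * H : ℝ) := by
          refine (norm_sum_le _ _).trans (Finset.sum_le_sum fun a ha => (shift a).trans ?_)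
          have := (Finset.mem_range.1 ha).le
          gcongr
      _ = _ := by simp; ring
  have hsq : ∑ n ∈ Finset.range N, ‖V n‖ ^ 2 ≤ H * N + H * H * (κ * N) := by
    have e : ((∑ n ∈ Finset.range N, ‖V n‖ ^ 2 : ℝ) : ℂ) =
        ∑ a ∈ Finset.range H, ∑ b ∈ Finset.range H,
          ∑ n ∈ Finset.range N, u (n + a) * (starRingEnd ℂ) (u (n + b)) := by
      push_cast
      have : ∀ n, ((‖V n‖ : ℂ)) ^ 2 = ∑ a ∈ Finset.range H, ∑ b ∈ Finset.range H,
          u (n + a) * (starRingEnd ℂ) (u (n + b)) := by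
        intro n
        rw [← Complex.ofReal_pow, ← Complex.normSq_eq_norm_sq, ← Complex.mul_conj, hV,
          map_sum, Finset.sum_mul_sum]
      simp only [this]
      rw [Finset.sum_comm]
      exact Finset.sum_congr rfl fun a _ => Finset.sum_comm
    have hpos : 0 ≤ ∑ n ∈ Finset.range N, ‖V n‖ ^ 2 := by positivity
    have e' : ∑ n ∈ Finset.range N, ‖V n‖ ^ 2 =
        ‖((∑ n ∈ Finset.range N, ‖V n‖ ^ 2 : ℝ) : ℂ)‖ := by
      rw [Complex.norm_real, Real.norm_of_nonneg hpos]
    rw [e', e]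
    calc _ ≤ ∑ a ∈ Finset.range H, ∑ b ∈ Finset.range H,
          ‖∑ n ∈ Finset.range N, u (n + a) * (starRingEnd ℂ) (u (n + b))‖ :=
          (norm_sum_le _ _).trans (Finset.sum_le_sum fun a _ => norm_sum_le _ _)
      _ ≤ ∑ a ∈ Finset.range H, ∑ b ∈ Finset.range H, ((if a = b then (N : ℝ) else 0) + κ * N) := by
          refine Finset.sum_le_sum fun a ha => Finset.sum_le_sum fun b hb => ?_
          split_ifs with hab
          · subst hab
            have : ‖∑ n ∈ Finset.range N, u (n + a) * (starRingEnd ℂ) (u (n + a))‖ ≤ N := by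
              calc _ ≤ ∑ n ∈ Finset.range N, (1 : ℝ) := by
                    refine (norm_sum_le _ _).trans (Finset.sum_le_sum fun n _ => ?_)
                    rw [norm_mul, RCLike.norm_conj]
                    exact mul_le_one₀ (hu _) (norm_nonneg _) (hu _)
                _ = N := by simp
            have h2 : 0 ≤ κ * N := by positivity
            linarith
          · simpa using h a (Finset.mem_range.1 ha) b (Finset.mem_range.1 hb) hab
      _ = H * N + H * H * (κ * N) := by
          simp only [Finset.sum_add_distrib, Finset.sum_ite_eq, Finset.sum_const,
            Finset.card_range, nsmul_eq_mul]
          rw [Finset.sum_congr rfl fun a ha => if_pos ha]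
          simp; ring
  have hVle : ‖∑ n ∈ Finset.range N, V n‖ ≤ √(N * (H * N + H * H * (κ * N))) := by
    apply Real.le_sqrt_of_sq_le
    calc ‖∑ n ∈ Finset.range N, V n‖ ^ 2 ≤ (∑ n ∈ Finset.range N, ‖V n‖) ^ 2 := by
          gcongr; exact norm_sum_le _ _
      _ ≤ (Finset.range N).card * ∑ n ∈ Finset.range N, ‖V n‖ ^ 2 := sq_sum_le_card_mul_sum_sq
      _ ≤ _ := by rw [Finset.card_range]; gcongr
  calc H * ‖S‖ = ‖((H : ℂ) * S - ∑ n ∈ Finset.range N, V n) + ∑ n ∈ Finset.range N, V n‖ := by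
        simp
    _ ≤ _ := (norm_add_le _ _).trans (add_le_add hdiff hVle)

/-- The exponential sums of `f` over `{0, …, N - 1}` exceed `η N` for infinitely many `N`. -/
def HasLargeWeylSums (η : ℝ) (f : Polynomial ℝ) : Prop :=
  ∃ᶠ N : ℕ in atTop, η * N < ‖∑ n ∈ Finset.range N, phase (f.eval (n : ℝ))‖

open Polynomial in
lemma HasLargeWeylSums.exists_taylor_sub {η : ℝ} (hη : 0 < η) :
    ∃ κ > 0, ∃ H : ℕ, ∀ f : ℝ[X], HasLargeWeylSums η f →
      ∃ a < H, ∃ b < H, a ≠ b ∧ HasLargeWeylSums κ (taylor (a : ℝ) f - taylor (b : ℝ) f) := by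
  obtain ⟨H, hH⟩ := exists_nat_gt (8 / η ^ 2)
  have hH0 : 0 < (H : ℝ) := lt_trans (by positivity) hH
  refine ⟨η ^ 2 / 8, by positivity, H, fun f hf => ?_⟩
  by_contra! hcon
  apply hf
  have hev : ∀ᶠ N : ℕ in atTop, ∀ a ∈ Finset.range H, ∀ b ∈ Finset.range H, a ≠ b →
      ‖∑ n ∈ Finset.range N, phase ((taylor (a : ℝ) f - taylor (b : ℝ) f).eval (n : ℝ))‖
        ≤ η ^ 2 / 8 * N := by
    rw [Filter.eventually_all_finset]
    intro a ha
    rw [Filter.eventually_all_finset]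
    intro b hb
    by_cases hab : a = b
    · simp [hab]
    have := hcon a (Finset.mem_range.1 ha) b (Finset.mem_range.1 hb) hab
    rw [HasLargeWeylSums, Filter.not_frequently] at this
    filter_upwards [this] with N hN _
    exact not_lt.1 hN
  have hbig : ∀ᶠ N : ℕ in atTop, 4 * H / η ≤ (N : ℝ) :=
    tendsto_natCast_atTop_atTop.eventually_ge_atTop _
  filter_upwards [hev, hbig] with N hN hNb
  rw [not_lt]
  have key := vanDerCorput (fun n => phase (f.eval (n : ℝ))) (fun n => (norm_phase _).le) H N
    (η ^ 2 / 8) (fun a ha b hb hab => by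
      have := hN a (Finset.mem_range.2 ha) b (Finset.mem_range.2 hb) hab
      simpa [taylor_eval, phase_sub] using this) (by positivity)
  have h1 : √(N * (H * N + H * H * (η ^ 2 / 8 * N))) ≤ H * N * (η / 2) := by
    apply Real.sqrt_le_iff.2 ⟨by positivity, ?_⟩
    have : 8 ≤ H * η ^ 2 := by
      rw [div_lt_iff₀ (by positivity)] at hH; exact hH.le
    have h8 : (N : ℝ) * (H * N) * 8 ≤ N * (H * N) * (H * η ^ 2) := by gcongr
    nlinarith
  have h2 : 2 * (H : ℝ) ≤ η / 2 * N := by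
    rw [div_le_iff₀ hη] at hNb; linarith
  have h3 : (H : ℝ) * ‖∑ n ∈ Finset.range N, phase (f.eval (n : ℝ))‖ ≤ H * (η * N) := by
    calc _ ≤ 2 * H * H + H * N * (η / 2) := key.trans (by gcongr)
      _ ≤ (η / 2 * N) * H + H * N * (η / 2) := by gcongr
      _ = _ := by ring
  exact le_of_mul_le_mul_left h3 hH0

lemma sum_range_mul_eq (u : ℕ → ℂ) (L M : ℕ) :
    ∑ n ∈ Finset.range (L * M), u n =
      ∑ j ∈ Finset.range L, ∑ m ∈ Finset.range M, u (L * m + j) := by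
  induction M with
  | zero => simp
  | succ M ih =>
    rw [Nat.mul_succ, Finset.sum_range_add, ih]
    simp [Finset.sum_range_succ, Finset.sum_add_distrib]

open Polynomial in
/-- Large exponential sums persist along some residue class modulo `L`. -/
lemma HasLargeWeylSums.exists_residue {η : ℝ} (hη : 0 < η) {L : ℕ} (hL : 0 < L) {f : ℝ[X]}
    (hf : HasLargeWeylSums η f) :
    ∃ j : ℕ, HasLargeWeylSums (η / 2) (f.comp (C (L : ℝ) * X + C (j : ℝ))) := by
  by_contra! hcon
  apply hf
  have hev : ∀ᶠ M : ℕ in atTop, ∀ j ∈ Finset.range L,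
      ‖∑ n ∈ Finset.range M, phase ((f.comp (C (L : ℝ) * X + C (j : ℝ))).eval (n : ℝ))‖
        ≤ η / 2 * M := by
    rw [Filter.eventually_all_finset]
    intro j _
    have := hcon j
    rw [HasLargeWeylSums, Filter.not_frequently] at this
    filter_upwards [this] with M hM
    exact not_lt.1 hM
  have hdiv : Tendsto (fun N : ℕ => N / L) atTop atTop := Nat.tendsto_div_const_atTop hL.ne'
  have hbig : ∀ᶠ N : ℕ in atTop, 2 * L / η ≤ (N : ℝ) :=
    tendsto_natCast_atTop_atTop.eventually_ge_atTop _
  filter_upwards [hdiv.eventually hev, hbig] with N hN hNb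
  rw [not_lt]
  set M := N / L
  have hNM : N = L * M + N % L := (Nat.div_add_mod N L).symm
  have h1 : ‖∑ n ∈ Finset.range (L * M), phase (f.eval (n : ℝ))‖ ≤ η / 2 * N := by
    rw [sum_range_mul_eq (fun n => phase (f.eval (n : ℝ)))]
    calc _ ≤ ∑ j ∈ Finset.range L, (η / 2 * M : ℝ) := by
          refine (norm_sum_le _ _).trans (Finset.sum_le_sum fun j hj => ?_)
          simpa using hN j hj
      _ = η / 2 * ((L * M : ℕ) : ℝ) := by push_cast; simp; ring
      _ ≤ η / 2 * N := by
          gcongr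
          exact Nat.mul_div_le N L
  have h2 : ‖∑ n ∈ Finset.range (N % L), phase (f.eval ((L * M + n : ℕ) : ℝ))‖ ≤ L := by
    calc _ ≤ ∑ n ∈ Finset.range (N % L), (1 : ℝ) :=
          (norm_sum_le _ _).trans (Finset.sum_le_sum fun n _ => (norm_phase _).le)
      _ = ((N % L : ℕ) : ℝ) := by simp
      _ ≤ L := by exact_mod_cast (Nat.mod_lt _ hL).le
  have h3 : (L : ℝ) ≤ η / 2 * N := by
    rw [div_le_iff₀ hη] at hNb; linarith
  rw [show Finset.range N = Finset.range (L * M + N % L) by rw [← hNM], Finset.sum_range_add]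
  refine (norm_add_le _ _).trans ?_
  linarith

open Polynomial in
lemma HasLargeWeylSums.exists_int_of_natDegree_le_one {η : ℝ} (hη : 0 < η) {f : ℝ[X]}
    (hd : f.natDegree ≤ 1) (hf : HasLargeWeylSums η f) : ∃ z : ℤ, (z : ℝ) = f.coeff 1 := by
  rw [← phase_eq_one_iff]
  by_contra hne
  apply hf
  set w := phase (f.coeff 1)
  have hw : 0 < ‖w - 1‖ := norm_pos_iff.2 (sub_ne_zero.2 hne)
  have hbig : ∀ᶠ N : ℕ in atTop, 2 / ‖w - 1‖ / η ≤ (N : ℝ) :=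
    tendsto_natCast_atTop_atTop.eventually_ge_atTop _
  filter_upwards [hbig] with N hN
  rw [not_lt]
  have e : ∀ n : ℕ, phase (f.eval (n : ℝ)) = phase (f.coeff 0) * w ^ n := by
    intro n
    rw [eq_X_add_C_of_natDegree_le_one hd]
    simp only [eval_add, eval_mul, eval_C, eval_X]
    rw [mul_comm, phase_add, phase_nsmul, mul_comm]
    simp [w]
  simp only [e]
  rw [← Finset.mul_sum, norm_mul, norm_phase, one_mul]
  have h1 : ‖w - 1‖ * ‖∑ n ∈ Finset.range N, w ^ n‖ ≤ 2 := by
    rw [← norm_mul, mul_geom_sum]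
    refine (norm_sub_le _ _).trans ?_
    rw [norm_pow, norm_phase]; norm_num
  rw [div_div, div_le_iff₀ (by positivity)] at hN
  have : ‖w - 1‖ * ‖∑ n ∈ Finset.range N, w ^ n‖ ≤ ‖w - 1‖ * (η * N) := by linarith
  exact le_of_mul_le_mul_left this hw

open Polynomial in
lemma coeff_taylor_sub_taylor (f : ℝ[X]) {k : ℕ} (hf : f.natDegree ≤ k + 1) (a b : ℝ) :
    (taylor a f - taylor b f).natDegree ≤ k ∧
      (taylor a f - taylor b f).coeff k = (k + 1) * (a - b) * f.coeff (k + 1) := by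
  have hco : ∀ r : ℝ, (taylor r f).coeff (k + 1) = f.coeff (k + 1) ∧
      (taylor r f).coeff k = f.coeff k + (k + 1) * r * f.coeff (k + 1) := by
    intro r
    have hr : ∀ n, (hasseDeriv n f).natDegree < k + 1 - n + 1 := fun n =>
      Nat.lt_succ_of_le ((natDegree_hasseDeriv_le f n).trans (by omega))
    constructor
    · rw [taylor_coeff, eval_eq_sum_range' (hr (k + 1))]
      simp [hasseDeriv_coeff]
    · rw [taylor_coeff, eval_eq_sum_range' (hr k)]
      simp [hasseDeriv_coeff, Finset.sum_range_succ, show k + 1 - k = 1 by omega, add_comm 1 k]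
      ring
  constructor
  · rw [natDegree_le_iff_coeff_eq_zero]
    intro N hN
    rcases Nat.lt_or_ge (k + 1) N with h | h
    · rw [coeff_sub, coeff_eq_zero_of_natDegree_lt, coeff_eq_zero_of_natDegree_lt, sub_zero] <;>
      · rw [natDegree_taylor]; omega
    · obtain rfl : N = k + 1 := by omega
      rw [coeff_sub, (hco a).1, (hco b).1, sub_self]
  · rw [coeff_sub, (hco a).2, (hco b).2]; ring

open Polynomial in
/-- If the exponential sums of a polynomial of degree at most `k + 1` are often large, then its
leading coefficient is rational with bounded denominator. -/
lemma exists_int_mul_coeff_top (k : ℕ) : ∀ η : ℝ, 0 < η → ∃ Q : ℕ, 0 < Q ∧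
    ∀ f : ℝ[X], f.natDegree ≤ k + 1 → HasLargeWeylSums η f →
      ∃ z : ℤ, (z : ℝ) = Q * f.coeff (k + 1) := by
  induction k with
  | zero =>
    intro η hη
    refine ⟨1, one_pos, fun f hd hf => ?_⟩
    simpa using hf.exists_int_of_natDegree_le_one hη hd
  | succ k ih =>
    intro η hη
    obtain ⟨κ, hκ, H, hH⟩ := HasLargeWeylSums.exists_taylor_sub hη
    obtain ⟨Q, hQ, hQf⟩ := ih κ hκ
    refine ⟨Q * (k + 2) * H.factorial, by positivity, fun f hd hf => ?_⟩
    obtain ⟨a, ha, b, hb, hab, hl⟩ := hH f hf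
    obtain ⟨hdeg, hco⟩ := coeff_taylor_sub_taylor f hd a b
    obtain ⟨z, hz⟩ := hQf _ hdeg hl
    have hdvd : ((a : ℤ) - b) ∣ (H.factorial : ℤ) := by
      have h1 : ((a : ℤ) - b).natAbs ∣ H.factorial :=
        Nat.dvd_factorial (by omega) (by omega)
      exact Int.natAbs_dvd_natAbs.1 (by simpa using h1)
    obtain ⟨c, hc⟩ := hdvd
    refine ⟨z * c, ?_⟩
    have hc' : (H.factorial : ℝ) = ((a : ℝ) - b) * c := by exact_mod_cast hc
    push_cast
    rw [hz, hco, hc']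
    push_cast
    ring

open Polynomial in
/-- If the exponential sums of a polynomial of degree at most `k` are often large, then its
nonconstant coefficients are rational with bounded denominator. -/
lemma exists_int_mul_coeff (k : ℕ) : ∀ η : ℝ, 0 < η → ∃ Q : ℕ, 0 < Q ∧
    ∀ f : ℝ[X], f.natDegree ≤ k → HasLargeWeylSums η f →
      ∃ (g : ℤ[X]) (c : ℝ), C (Q : ℝ) * f = g.map (Int.castRingHom ℝ) + C c := by
  induction k with
  | zero =>
    intro η hη
    refine ⟨1, one_pos, fun f hd _ => ⟨0, f.coeff 0, ?_⟩⟩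
    simpa using eq_C_of_natDegree_le_zero hd
  | succ k ih =>
    intro η hη
    obtain ⟨L, hL, hLf⟩ := exists_int_mul_coeff_top k η hη
    obtain ⟨Q, hQ, hQf⟩ := ih (η / 2) (by positivity)
    refine ⟨Q * L ^ (k + 1), by positivity, fun f hd hf => ?_⟩
    obtain ⟨z, hz⟩ := hLf f hd hf
    obtain ⟨j, hj⟩ := hf.exists_residue hη hL
    set F := f.comp (C (L : ℝ) * X + C (j : ℝ)) with hF
    set f₂ := taylor (j : ℝ) f with hf₂
    have hFf : F = f₂.comp (C (L : ℝ) * X) := by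
      rw [hF, hf₂, taylor_apply, comp_assoc]; simp
    have hFco : ∀ i, F.coeff i = f₂.coeff i * (L : ℝ) ^ i := by
      intro i; rw [hFf, comp_C_mul_X_coeff]
    have hf₂deg : f₂.natDegree ≤ k + 1 := by rw [hf₂, natDegree_taylor]; exact hd
    have hf₂top : f₂.coeff (k + 1) = f.coeff (k + 1) := by
      rw [hf₂, taylor_coeff, eval_eq_sum_range' (n := 1)
        (Nat.lt_succ_of_le ((natDegree_hasseDeriv_le f (k + 1)).trans (by omega)))]
      simp [hasseDeriv_coeff]
    have htop : F.coeff (k + 1) = ((z * L ^ k : ℤ) : ℝ) := by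
      rw [hFco, hf₂top]; push_cast; rw [hz]; ring
    set G := F - C (F.coeff (k + 1)) * X ^ (k + 1) with hG
    have hGdeg : G.natDegree ≤ k := by
      rw [natDegree_le_iff_coeff_eq_zero]
      intro N hN
      rcases Nat.lt_or_ge (k + 1) N with h | h
      · rw [hG, coeff_sub, coeff_C_mul_X_pow, if_neg (by omega), hFco,
          coeff_eq_zero_of_natDegree_lt (by omega)]
        simp
      · obtain rfl : N = k + 1 := by omega
        simp [hG]
    have hGl : HasLargeWeylSums (η / 2) G := by
      have : ∀ n : ℕ, phase (G.eval (n : ℝ)) = phase (F.eval (n : ℝ)) := by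
        intro n
        have h1 : F.eval (n : ℝ) = G.eval (n : ℝ) + ((z * L ^ k * n ^ (k + 1) : ℤ) : ℝ) := by
          rw [hG, eval_sub, eval_mul, eval_C, eval_pow, eval_X, htop]; push_cast; ring
        rw [h1, phase_add, phase_intCast, mul_one]
      simpa only [HasLargeWeylSums, this] using hj
    obtain ⟨g, c, hgc⟩ := hQf G hGdeg hGl
    have hint : ∀ i, i ≠ 0 → ∃ y : ℤ, (y : ℝ) = Q * (f₂.coeff i * (L : ℝ) ^ i) := by
      intro i hi
      refine ⟨g.coeff i + Q * (if i = k + 1 then z * L ^ k else 0), ?_⟩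
      have h1 := congrArg (fun q => coeff q i) hgc
      simp only [coeff_C_mul, coeff_add, coeff_map, coeff_C, if_neg hi, add_zero, hG, coeff_sub,
        coeff_X_pow, htop] at h1
      rw [← hFco]
      split_ifs at h1 ⊢ with h
      · subst h
        simp only [eq_intCast] at h1
        push_cast at h1 ⊢; rw [← h1]; ring
      · simp at h1 ⊢; rw [← h1]
    have hint' : ∀ i, ∃ y : ℤ, i ≠ 0 → (y : ℝ) = ((Q * L ^ (k + 1) : ℕ) : ℝ) * f₂.coeff i := by
      intro i
      by_cases hi : i = 0
      · exact ⟨0, fun h => absurd hi h⟩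
      rcases Nat.lt_or_ge (k + 1) i with h | h
      · exact ⟨0, fun _ => by rw [coeff_eq_zero_of_natDegree_lt (by omega)]; simp⟩
      obtain ⟨y, hy⟩ := hint i hi
      refine ⟨y * L ^ (k + 1 - i), fun _ => ?_⟩
      push_cast
      rw [hy, show (L : ℝ) ^ (k + 1) = L ^ i * L ^ (k + 1 - i) by
        rw [← pow_add]; congr 1; omega]
      ring
    choose y hy using hint'
    set g₂ : ℤ[X] := ∑ i ∈ Finset.Icc 1 (k + 1), C (y i) * X ^ i with hg₂
    have hf₂eq : C ((Q * L ^ (k + 1) : ℕ) : ℝ) * f₂ = g₂.map (Int.castRingHom ℝ) +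
        C (((Q * L ^ (k + 1) : ℕ) : ℝ) * f₂.coeff 0) := by
      ext i
      rw [coeff_C_mul, coeff_add, coeff_map, hg₂, finsetSum_coeff, coeff_C]
      simp only [coeff_C_mul, coeff_X_pow, mul_ite, mul_one, mul_zero, Finset.sum_ite_eq,
        Finset.mem_Icc]
      by_cases hi : i = 0
      · subst hi; simp
      · rw [if_neg hi, add_zero]
        split_ifs with h
        · simpa using (hy i hi).symm
        · rw [coeff_eq_zero_of_natDegree_lt (by omega)]; simp
    refine ⟨taylor (-j : ℤ) g₂, ((Q * L ^ (k + 1) : ℕ) : ℝ) * f₂.coeff 0, ?_⟩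
    have h1 := congrArg (taylor (-(j : ℝ))) hf₂eq
    rw [taylor_mul, taylor_C, map_add, taylor_C, hf₂, taylor_taylor, neg_add_cancel,
      taylor_zero] at h1
    rw [map_taylor, h1]
    simp [hf₂]

/-- The character of the torus `𝕋^d` attached to `v ∈ ℤ^d`. -/
noncomputable def torusChar {d : ℕ} (v : Fin d → ℤ) (α : Fin d → AddCircle (1 : ℝ)) : ℂ :=
  (AddCircle.toCircle (∑ i, (v i) • (α i)) : ℂ)

lemma continuous_torusChar {d : ℕ} (v : Fin d → ℤ) : Continuous (torusChar v) := by
  unfold torusChar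
  have h : Continuous (AddCircle.toCircle : AddCircle (1 : ℝ) → Circle) :=
    AddCircle.continuous_toCircle
  fun_prop

lemma norm_torusChar {d : ℕ} (v : Fin d → ℤ) (α : Fin d → AddCircle (1 : ℝ)) :
    ‖torusChar v α‖ = 1 := Circle.norm_coe _

lemma torusChar_zero_right {d : ℕ} (v : Fin d → ℤ) : torusChar v 0 = 1 := by
  simp [torusChar]

lemma torusChar_sub {d : ℕ} (v w : Fin d → ℤ) (α : Fin d → AddCircle (1 : ℝ)) :
    torusChar (w - v) α = torusChar w α * (starRingEnd ℂ) (torusChar v α) := by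
  have h : torusChar w α = torusChar (w - v) α * torusChar v α := by
    unfold torusChar
    rw [← Circle.coe_mul, ← AddCircle.toCircle_add, ← Finset.sum_add_distrib]
    simp [sub_zsmul]
  rw [h, mul_assoc, Complex.mul_conj, Complex.normSq_eq_norm_sq, norm_torusChar]
  simp

lemma integrable_torusChar {d : ℕ} (v : Fin d → ℤ) (σ : Measure (Fin d → AddCircle (1 : ℝ)))
    [IsFiniteMeasure σ] : Integrable (torusChar v) σ :=
  Integrable.of_bound (continuous_torusChar v).aestronglyMeasurable 1
    (Eventually.of_forall fun α => (norm_torusChar v α).le)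

section Action

variable {X : Type} [MeasurableSpace X] {μ : Measure X} [IsProbabilityMeasure μ] {d : ℕ}
  {T : (Fin d → ℤ) → X → X} {A : Set X} {σ : Measure (Fin d → AddCircle (1 : ℝ))}

/-- The indicator of `(T v)⁻¹ A` as an element of `L²(μ)`. -/
noncomputable def preimageIndicator (hT : IsMPAction d T μ) (hA : MeasurableSet A)
    (v : Fin d → ℤ) : Lp ℝ 2 μ :=
  indicatorConstLp 2 ((hT.2.2 v).measurable hA) (measure_ne_top _ _) 1

lemma inner_preimageIndicator (hT : IsMPAction d T μ) (hA : MeasurableSet A)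
    (v w : Fin d → ℤ) :
    inner ℝ (preimageIndicator hT hA v) (preimageIndicator hT hA w) =
      (μ (A ∩ T (w - v) ⁻¹' A)).toReal := by
  rw [preimageIndicator, preimageIndicator,
    L2.real_inner_indicatorConstLp_one_indicatorConstLp_one, Measure.real,
    ← (hT.2.2 v).measure_preimage (hA.inter ((hT.2.2 _).measurable hA)).nullMeasurableSet,
    Set.preimage_inter, ← Set.preimage_comp, ← hT.2.1, sub_add_cancel]

lemma compMeasurePreserving_preimageIndicator (hT : IsMPAction d T μ) (hA : MeasurableSet A)
    (v w : Fin d → ℤ) :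
    Lp.compMeasurePreserving (T v) (hT.2.2 v) (preimageIndicator hT hA w) =
      preimageIndicator hT hA (w + v) := by
  rw [preimageIndicator, Lp.indicatorConstLp_compMeasurePreserving, preimageIndicator]
  congr 1
  rw [← Set.preimage_comp, ← hT.2.1]

lemma inner_indicator_preimageIndicator (hT : IsMPAction d T μ) (hA : MeasurableSet A)
    {U : Set X} (hU : MeasurableSet U) (v : Fin d → ℤ) (hv : T v ⁻¹' A ⊆ U) :
    inner ℝ (indicatorConstLp 2 hU (measure_ne_top μ U) (1 : ℝ)) (preimageIndicator hT hA v) =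
      (μ A).toReal := by
  rw [preimageIndicator, L2.real_inner_indicatorConstLp_one_indicatorConstLp_one,
    Set.inter_eq_right.2 hv, Measure.real, (hT.2.2 v).measure_preimage hA.nullMeasurableSet]

/-- The spectral measure computes the norm of linear combinations of translates. -/
lemma norm_sum_preimageIndicator_sq [IsFiniteMeasure σ] (hT : IsMPAction d T μ)
    (hA : MeasurableSet A) (hσ : IsSpectralMeasure d T μ A σ) {ι : Type*} (s : Finset ι)
    (c : ι → ℝ) (v : ι → Fin d → ℤ) :
    ‖∑ i ∈ s, c i • preimageIndicator hT hA (v i)‖ ^ 2 =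
      ∫ α, ‖∑ i ∈ s, (c i : ℂ) * torusChar (v i) α‖ ^ 2 ∂σ := by
  apply Complex.ofReal_injective
  rw [← integral_complex_ofReal]
  have h1 : ∀ α, ((‖∑ i ∈ s, (c i : ℂ) * torusChar (v i) α‖ ^ 2 : ℝ) : ℂ) =
      ∑ i ∈ s, ∑ j ∈ s, (c i * c j : ℂ) * torusChar (v i - v j) α := by
    intro α
    rw [← Complex.normSq_eq_norm_sq, ← Complex.mul_conj, map_sum, Finset.sum_mul_sum]
    refine Finset.sum_congr rfl fun i _ => Finset.sum_congr rfl fun j _ => ?_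
    rw [torusChar_sub, map_mul, Complex.conj_ofReal]
    ring
  have hint : ∀ i j, Integrable (fun α => (c i * c j : ℂ) * torusChar (v i - v j) α) σ :=
    fun i j => (integrable_torusChar _ σ).const_mul _
  simp only [h1]
  rw [integral_finsetSum _ fun i _ => integrable_finsetSum _ fun j _ => hint i j,
    ← real_inner_self_eq_norm_sq, sum_inner]
  push_cast
  refine Finset.sum_congr rfl fun i _ => ?_
  rw [integral_finsetSum _ fun j _ => hint i j, inner_sum]
  push_cast
  refine Finset.sum_congr rfl fun j _ => ?_
  rw [integral_const_mul, real_inner_smul_left, real_inner_smul_right, real_inner_comm,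
    inner_preimageIndicator]
  push_cast
  rw [hσ]
  simp only [torusChar, mul_assoc]

/-- A square-integrable function invariant under an ergodic action is constant. -/
lemma IsErgodicAction.exists_ae_eq_const (hT : IsErgodicAction d T μ) (g : Lp ℝ 2 μ)
    (hg : ∀ v, Lp.compMeasurePreserving (T v) (hT.1.2.2 v) g = g) :
    ∃ c : ℝ, g =ᵐ[μ] fun _ => c := by
  have hm : Measurable g := (Lp.stronglyMeasurable g).measurable
  refine exists_eventuallyEq_const_of_forall_separating MeasurableSet fun U hU => ?_
  have hinv : ∀ v, μ ((T v ⁻¹' (g ⁻¹' U)) ∆ (g ⁻¹' U)) = 0 := by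
    intro v
    rw [measure_symmDiff_eq_zero_iff]
    have h1 := Lp.coeFn_compMeasurePreserving g (hT.1.2.2 v)
    rw [hg v] at h1
    filter_upwards [h1] with x hx
    apply propext
    change g (T v x) ∈ U ↔ g x ∈ U
    rw [hx]; rfl
  rcases hT.2 (g ⁻¹' U) (hm hU) hinv with h | h
  · right
    exact measure_eq_zero_iff_ae_notMem.1 h
  · left
    exact (mem_ae_iff_prob_eq_one (hm hU)).2 h

/-- For an ergodic action, convex combinations of translates of `1_A` come arbitrarily close to the
norm of the constant `μ(A)`. -/
lemma IsErgodicAction.exists_convexHull_norm_sq_lt (hT : IsErgodicAction d T μ)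
    (hA : MeasurableSet A) {ε : ℝ} (hε : 0 < ε) :
    ∃ w ∈ convexHull ℝ (Set.range (preimageIndicator hT.1 hA)),
      ‖w‖ ^ 2 < (μ A).toReal ^ 2 + ε := by
  set K₀ := convexHull ℝ (Set.range (preimageIndicator hT.1 hA)) with hK₀
  set K := closure K₀ with hK
  have hconv : Convex ℝ K := (convex_convexHull ℝ _).closure
  have hne : K.Nonempty :=
    ⟨preimageIndicator hT.1 hA 0, subset_closure (subset_convexHull ℝ _ ⟨0, rfl⟩)⟩
  obtain ⟨g, hgK, hg⟩ := exists_norm_eq_iInf_of_complete_convex hne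
    isClosed_closure.isComplete hconv 0
  rw [norm_eq_iInf_iff_real_inner_le_zero hconv hgK] at hg
  have hmaps : ∀ v, Lp.compMeasurePreserving (T v) (hT.1.2.2 v) g ∈ K := by
    intro v
    set L := Lp.compMeasurePreservingₗᵢ (p := 2) (E := ℝ) ℝ (T v) (hT.1.2.2 v) with hL
    have h1 : Set.MapsTo L K₀ K₀ := by
      rw [Set.mapsTo_iff_image_subset, hK₀]
      have := L.toLinearMap.image_convexHull (Set.range (preimageIndicator hT.1 hA))
      rw [LinearIsometry.coe_toLinearMap] at this
      rw [this]
      apply convexHull_mono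
      rintro _ ⟨_, ⟨w, rfl⟩, rfl⟩
      exact ⟨w + v, (compMeasurePreserving_preimageIndicator hT.1 hA v w).symm⟩
    exact (h1.closure L.continuous) hgK
  have hinv : ∀ v, Lp.compMeasurePreserving (T v) (hT.1.2.2 v) g = g := by
    intro v
    set g' := Lp.compMeasurePreserving (T v) (hT.1.2.2 v) g with hg'
    have h1 := hg g' (hmaps v)
    have h2 : ‖g'‖ = ‖g‖ := Lp.norm_compMeasurePreserving g (hT.1.2.2 v)
    rw [zero_sub, inner_neg_left, inner_sub_right, real_inner_self_eq_norm_sq] at h1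
    have h3 := norm_sub_sq_real g' g
    rw [h2, real_inner_comm] at h3
    have h4 : ‖g' - g‖ ^ 2 ≤ 0 := by linarith
    have h5 : ‖g' - g‖ = 0 := by nlinarith [norm_nonneg (g' - g)]
    exact sub_eq_zero.1 (norm_eq_zero.1 h5)
  obtain ⟨c, hc⟩ := hT.exists_ae_eq_const g hinv
  set one : Lp ℝ 2 μ := indicatorConstLp 2 MeasurableSet.univ (measure_ne_top μ _) 1 with hone
  have hgc : g = c • one := by
    apply Lp.ext
    have h1 := Lp.coeFn_smul c one
    have h2 : one =ᵐ[μ] Set.indicator Set.univ fun _ => (1 : ℝ) := indicatorConstLp_coeFn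
    filter_upwards [hc, h1, h2] with x hx1 hx2 hx3
    rw [hx1, hx2, Pi.smul_apply, hx3]
    simp
  have hone1 : inner ℝ one one = (1 : ℝ) := by
    rw [hone, L2.real_inner_indicatorConstLp_one_indicatorConstLp_one]
    simp
  have hinner : inner ℝ one g = (μ A).toReal := by
    have hcl : IsClosed {h : Lp ℝ 2 μ | inner ℝ one h = (μ A).toReal} :=
      isClosed_eq (by fun_prop) continuous_const
    have hcv : Convex ℝ {h : Lp ℝ 2 μ | inner ℝ one h = (μ A).toReal} := by
      intro x hx y hy a b _ _ hab
      simp only [Set.mem_ofPred_eq] at hx hy ⊢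
      rw [inner_add_right, real_inner_smul_right, real_inner_smul_right, hx, hy, ← add_mul, hab,
        one_mul]
    refine closure_minimal (convexHull_min ?_ hcv) hcl hgK
    rintro _ ⟨v, rfl⟩
    exact inner_indicator_preimageIndicator hT.1 hA MeasurableSet.univ v (Set.subset_univ _)
  have hcA : c = (μ A).toReal := by
    rw [← hinner, hgc, real_inner_smul_right, hone1, mul_one]
  have hgn : ‖g‖ ^ 2 = (μ A).toReal ^ 2 := by
    rw [← real_inner_self_eq_norm_sq, hgc, real_inner_smul_left, real_inner_smul_right, hone1, hcA]
    ring
  have hopen : {h : Lp ℝ 2 μ | ‖h‖ ^ 2 < (μ A).toReal ^ 2 + ε} ∈ nhds g := by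
    apply IsOpen.mem_nhds (isOpen_lt (by fun_prop) continuous_const)
    simp only [Set.mem_ofPred_eq, hgn]
    linarith
  obtain ⟨w, hw1, hw2⟩ := mem_closure_iff_nhds.1 hgK _ hopen
  exact ⟨w, hw2, hw1⟩

/-- For an ergodic action, the spectral measure of `A` has mass at most `μ(A)²` at the origin. -/
lemma IsErgodicAction.spectralMeasure_zero_le [IsFiniteMeasure σ] (hT : IsErgodicAction d T μ)
    (hA : MeasurableSet A) (hσ : IsSpectralMeasure d T μ A σ) :
    σ.real {0} ≤ (μ A).toReal ^ 2 := by
  refine le_of_forall_pos_le_add fun ε hε => ?_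
  obtain ⟨w, hw, hwn⟩ := hT.exists_convexHull_norm_sq_lt hA hε
  obtain ⟨ι, _, c, z, -, hc1, hz, rfl⟩ := mem_convexHull_iff_exists_fintype.1 hw
  choose v hv using hz
  simp only [← hv] at hwn
  rw [norm_sum_preimageIndicator_sq hT.1 hA hσ] at hwn
  refine le_trans ?_ hwn.le
  have hcont : Continuous fun α => ‖∑ i, (c i : ℂ) * torusChar (v i) α‖ ^ 2 := by
    have := fun i => continuous_torusChar (v i)
    fun_prop
  calc σ.real {0} = ∫ α in {0}, ‖∑ i, (c i : ℂ) * torusChar (v i) α‖ ^ 2 ∂σ := by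
        rw [integral_singleton]
        simp only [torusChar_zero_right, mul_one, ← Complex.ofReal_sum, hc1]
        simp
    _ ≤ _ := setIntegral_le_integral (hcont.integrable_of_hasCompactSupport
        (HasCompactSupport.of_compactSpace _)) (Eventually.of_forall fun α => by positivity)

end Action

/-- Linearly independent integer polynomials admit an integral dual system of coefficient
functionals, up to a common denominator. -/
lemma exists_dual_coefficients {r d : ℕ} (p : Fin d → MvPolynomial (Fin r) ℤ)
    (hind : LinearIndependent ℚ fun i => (p i).map (Int.castRingHom ℚ)) :
    ∃ (D : ℕ) (z : Fin d → (Fin r →₀ ℕ) → ℤ), 0 < D ∧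
      ∀ S : Finset (Fin r →₀ ℕ), (∀ i, (p i).support ⊆ S) → ∀ i l,
        ∑ m ∈ S, z i m * (p l).coeff m = if l = i then (D : ℤ) else 0 := by
  obtain ⟨φ, hφ⟩ := LinearMap.exists_leftInverse_of_injective
    (Finsupp.linearCombination ℚ fun i => (p i).map (Int.castRingHom ℚ))
    (linearIndependent_iff_ker.1 hind)
  set S₀ : Finset (Fin r →₀ ℕ) := Finset.univ.biUnion fun i => (p i).support with hS₀
  set w : Fin d → (Fin r →₀ ℕ) → ℚ := fun i m => φ (MvPolynomial.monomial m 1) i with hw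
  obtain ⟨b, hb⟩ := IsLocalization.exist_integer_multiples_of_finset (nonZeroDivisors ℤ)
    ((Finset.univ ×ˢ S₀).image fun x => w x.1 x.2)
  have hz : ∀ i m, ∃ y : ℤ, m ∈ S₀ → (y : ℚ) = ((b : ℤ).natAbs : ℚ) * w i m := by
    intro i m
    by_cases hm : m ∈ S₀
    · obtain ⟨y, hy⟩ := hb (w i m) (Finset.mem_image.2 ⟨(i, m), by simp [hm], rfl⟩)
      have hy' : (y : ℚ) = ((b : ℤ) : ℚ) * w i m := by simpa [Algebra.smul_def] using hy
      rcases Int.natAbs_eq (b : ℤ) with h | h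
      · exact ⟨y, fun _ => by rw [hy', h]; simp⟩
      · refine ⟨-y, fun _ => ?_⟩
        push_cast
        rw [hy', h]; simp
    · exact ⟨0, fun h => absurd h hm⟩
  choose z hz using hz
  refine ⟨(b : ℤ).natAbs, z, Int.natAbs_pos.2 (nonZeroDivisors.ne_zero b.2), fun S hS i l => ?_⟩
  have hsub : ∀ T : Finset (Fin r →₀ ℕ), (p l).support ⊆ T →
      ∑ m ∈ T, z i m * (p l).coeff m = ∑ m ∈ (p l).support, z i m * (p l).coeff m := by
    intro T hT
    refine (Finset.sum_subset hT fun m _ hm => ?_).symm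
    rw [MvPolynomial.notMem_support_iff.1 hm, mul_zero]
  rw [hsub S (hS l)]
  have h1 : φ ((p l).map (Int.castRingHom ℚ)) i = if l = i then 1 else 0 := by
    have := congrArg (fun ψ => ψ (Finsupp.single l 1) i) hφ
    simpa [Finsupp.single_apply] using this
  have h2 : (p l).map (Int.castRingHom ℚ) =
      ∑ m ∈ (p l).support, (((p l).coeff m : ℤ) : ℚ) • MvPolynomial.monomial m (1 : ℚ) := by
    conv_lhs => rw [(p l).as_sum, map_sum]
    refine Finset.sum_congr rfl fun m _ => ?_
    simp [MvPolynomial.map_monomial, MvPolynomial.smul_monomial]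
  rw [h2, map_sum, Finsupp.finsetSum_apply] at h1
  have h3 : ((∑ m ∈ (p l).support, z i m * (p l).coeff m : ℤ) : ℚ) =
      (((if l = i then ((b : ℤ).natAbs : ℤ) else 0) : ℤ) : ℚ) := by
    push_cast
    calc _ = ∑ m ∈ (p l).support, ((b : ℤ).natAbs : ℚ) * ((((p l).coeff m : ℤ) : ℚ) * w i m) := by
          refine Finset.sum_congr rfl fun m hm => ?_
          rw [hz i m (Finset.mem_biUnion.2 ⟨l, Finset.mem_univ _, hm⟩)]
          ring
      _ = ((b : ℤ).natAbs : ℚ) * (if l = i then 1 else 0) := by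
          rw [← Finset.mul_sum, ← h1]
          simp [hw]
      _ = _ := by split_ifs <;> simp
  exact_mod_cast h3

/-- Kronecker substitution: some weight function separates a finite set of exponents. -/
lemma exists_injOn_weight {r : ℕ} (S : Finset (Fin r →₀ ℕ)) :
    ∃ w : Fin r → ℕ, (∀ i, 0 < w i) ∧
      Set.InjOn (fun m : Fin r →₀ ℕ => ∑ i, m i * w i) S := by
  set K := (S.sup fun m => Finset.univ.sup fun i => m i) + 1 with hK
  have hlt : ∀ m ∈ S, ∀ i, m i < K := fun m hm i =>
    Nat.lt_succ_of_le ((Finset.le_sup (f := fun i => m i) (Finset.mem_univ i)).trans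
      (Finset.le_sup (f := fun m : Fin r →₀ ℕ => Finset.univ.sup fun i => m i) hm))
  refine ⟨fun i => K ^ (i : ℕ), fun i => by positivity, fun m hm m' hm' h => ?_⟩
  have h1 : finFunctionFinEquiv (fun i => (⟨m i, hlt m hm i⟩ : Fin K)) =
      finFunctionFinEquiv (fun i => (⟨m' i, hlt m' hm' i⟩ : Fin K)) := by
    apply Fin.ext
    simpa [finFunctionFinEquiv_apply] using h
  ext i
  simpa using congrFun (finFunctionFinEquiv.injective h1) i

open Polynomial in
/-- Along a suitable curve, the exponential sums of a polynomial map are eventually small away from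
the torsion points of bounded order. -/
lemma exists_eventually_norm_sum_torusChar_le {r d : ℕ} (p : Fin d → MvPolynomial (Fin r) ℤ)
    (hp0 : ∀ i, MvPolynomial.constantCoeff (p i) = 0)
    (hind : LinearIndependent ℚ fun i => (p i).map (Int.castRingHom ℚ)) {η : ℝ} (hη : 0 < η) :
    ∃ M : ℕ, 0 < M ∧ ∃ x : ℕ → Fin r → ℤ, ∀ α : Fin d → AddCircle (1 : ℝ), α ≠ 0 →
      α ∉ ratTorsion d M → ∀ᶠ N : ℕ in atTop,
        ‖∑ n ∈ Finset.range N, torusChar (fun i => MvPolynomial.eval (x n) (p i)) α‖ ≤ η * N := by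
  obtain ⟨D, z, hD, hz⟩ := exists_dual_coefficients p hind
  set S : Finset (Fin r →₀ ℕ) := Finset.univ.biUnion fun i => (p i).support with hS
  have hpS : ∀ i, (p i).support ⊆ S := fun i =>
    Finset.subset_biUnion_of_mem (fun i => (p i).support) (Finset.mem_univ i)
  obtain ⟨w, hw0, hw⟩ := exists_injOn_weight S
  set W : (Fin r →₀ ℕ) → ℕ := fun m => ∑ i, m i * w i with hW
  set q : Fin d → ℤ[X] := fun i => ∑ m ∈ S, C ((p i).coeff m) * X ^ W m with hq
  have hqco : ∀ i, ∀ m ∈ S, (q i).coeff (W m) = (p i).coeff m := by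
    intro i m hm
    rw [hq, finsetSum_coeff, Finset.sum_eq_single_of_mem m hm]
    · simp
    · intro m' hm' hne
      rw [coeff_C_mul, coeff_X_pow, if_neg, mul_zero]
      exact fun h => hne (hw hm' hm h.symm)
  have hqev : ∀ i (n : ℤ), (q i).eval n = MvPolynomial.eval (fun j => n ^ w j) (p i) := by
    intro i n
    rw [MvPolynomial.eval_eq', hq, eval_finsetSum]
    rw [← Finset.sum_subset (hpS i) fun m _ hm => by
      rw [MvPolynomial.notMem_support_iff.1 hm]; simp]
    refine Finset.sum_congr rfl fun m _ => ?_
    simp only [eval_mul, eval_C, eval_pow, eval_X, hW]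
    rw [← Finset.prod_pow_eq_pow_sum]
    congr 1
    refine Finset.prod_congr rfl fun j _ => ?_
    rw [← pow_mul, mul_comm]
  obtain ⟨Q, hQ, hQf⟩ := exists_int_mul_coeff (Finset.univ.sup fun i => (q i).natDegree) η hη
  refine ⟨Q * D, by positivity, fun n j => (n : ℤ) ^ w j, fun α hα0 hαM => ?_⟩
  choose x hx using fun i => QuotientAddGroup.mk_surjective (α i)
  set f : ℝ[X] := ∑ i, C (x i) * (q i).map (Int.castRingHom ℝ) with hf
  have hfdeg : f.natDegree ≤ Finset.univ.sup fun i => (q i).natDegree := by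
    refine natDegree_sum_le_of_forall_le _ _ fun i _ => ?_
    refine (natDegree_C_mul_le _ _).trans (natDegree_map_le.trans ?_)
    exact Finset.le_sup (f := fun i => (q i).natDegree) (Finset.mem_univ i)
  have hphase : ∀ n : ℕ, phase (f.eval (n : ℝ)) =
      torusChar (fun i => MvPolynomial.eval (fun j => (n : ℤ) ^ w j) (p i)) α := by
    intro n
    have h1 : f.eval (n : ℝ) = ∑ i, (q i).eval (n : ℤ) • x i := by
      rw [hf, eval_finsetSum]
      refine Finset.sum_congr rfl fun i _ => ?_
      have h2 : ((q i).map (Int.castRingHom ℝ)).eval (n : ℝ) = (((q i).eval (n : ℤ) : ℤ) : ℝ) := by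
        simp
      rw [eval_mul, eval_C, h2, zsmul_eq_mul, mul_comm]
    rw [h1, phase, torusChar]
    congr 2
    have h3 : ∀ y : Fin d → ℝ,
        ((∑ i, y i : ℝ) : AddCircle (1 : ℝ)) = ∑ i, (y i : AddCircle (1 : ℝ)) :=
      fun y => map_sum (QuotientAddGroup.mk' _) y _
    rw [h3]
    refine Finset.sum_congr rfl fun i _ => ?_
    rw [AddCircle.coe_zsmul, hqev, ← hx i]
  by_contra hcon
  have hlarge : HasLargeWeylSums η f := by
    rw [Filter.not_eventually] at hcon
    refine hcon.mono fun N hN => ?_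
    simpa only [hphase] using not_le.1 hN
  obtain ⟨g, c, hgc⟩ := hQf f hfdeg hlarge
  have hco : ∀ m ∈ S, ∃ y : ℤ, (y : ℝ) = Q * ∑ l, x l * (((p l).coeff m : ℤ) : ℝ) := by
    intro m hm
    have h1 : f.coeff (W m) = ∑ l, x l * (((p l).coeff m : ℤ) : ℝ) := by
      rw [hf, finsetSum_coeff]
      refine Finset.sum_congr rfl fun l _ => ?_
      rw [coeff_C_mul, coeff_map, hqco l m hm]
      simp
    by_cases hm0 : m = 0
    · refine ⟨0, ?_⟩
      have : ∀ l, (p l).coeff m = 0 := fun l => by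
        rw [hm0, ← MvPolynomial.constantCoeff_eq]; exact hp0 l
      simp [this]
    · have hWm : W m ≠ 0 := by
        obtain ⟨i, hi⟩ := Finsupp.ne_iff.1 hm0
        have : 0 < m i * w i := Nat.mul_pos (Nat.pos_of_ne_zero hi) (hw0 i)
        exact (lt_of_lt_of_le this (Finset.single_le_sum (f := fun i => m i * w i)
          (fun _ _ => Nat.zero_le _) (Finset.mem_univ i))).ne'
      refine ⟨g.coeff (W m), ?_⟩
      have h2 := congrArg (fun P => coeff P (W m)) hgc
      simp only [coeff_C_mul, coeff_add, coeff_map, coeff_C, if_neg hWm, add_zero] at h2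
      rw [← h1, h2]; simp
  choose! y hy using hco
  refine hαM ⟨hα0, Q * D, Nat.succ_le_of_lt (by positivity), le_rfl, ?_⟩
  ext i
  have hi : ((∑ m ∈ S, z i m * y m : ℤ) : ℝ) = (Q * D : ℕ) * x i := by
    push_cast
    have h1 : ∀ l, ∑ m ∈ S, (z i m : ℝ) * (((p l).coeff m : ℤ) : ℝ) = if l = i then (D : ℝ) else 0 := by
      intro l
      have := congrArg (Int.cast : ℤ → ℝ) (hz S hpS i l)
      push_cast at this
      exact this
    calc ∑ m ∈ S, (z i m : ℝ) * y m
        = ∑ m ∈ S, ∑ l, Q * x l * ((z i m : ℝ) * (((p l).coeff m : ℤ) : ℝ)) := by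
          refine Finset.sum_congr rfl fun m hm => ?_
          rw [hy m hm, Finset.mul_sum, Finset.mul_sum]
          exact Finset.sum_congr rfl fun l _ => by ring
      _ = ∑ l, Q * x l * (if l = i then (D : ℝ) else 0) := by
          rw [Finset.sum_comm]
          exact Finset.sum_congr rfl fun l _ => by rw [← Finset.mul_sum, h1]
      _ = Q * D * x i := by simp; ring
  have h0 : (((Q * D) • x i : ℝ) : AddCircle (1 : ℝ)) = 0 := by
    rw [AddCircle.coe_eq_zero_iff]
    exact ⟨∑ m ∈ S, z i m * y m, by rw [nsmul_eq_mul, ← hi]; simp⟩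
  rw [AddCircle.coe_nsmul] at h0
  rw [Pi.smul_apply, ← hx i]
  exact h0

lemma measurableSet_ratTorsion (d M : ℕ) : MeasurableSet (ratTorsion d M) := by
  have h : ratTorsion d M = {0}ᶜ ∩ ⋃ q ∈ Finset.Icc 1 M, {α | q • α = 0} := by
    ext α
    simp [ratTorsion, and_assoc]
  rw [h]
  refine (measurableSet_singleton 0).compl.inter (Finset.measurableSet_biUnion _ fun q _ => ?_)
  exact (isClosed_eq (continuous_const_smul q) continuous_const).measurableSet

/-- If the normalised exponential sums are eventually at most `η` off a set `E`, then the mean square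
of the normalised exponential sums is eventually at most `σ(E) + η²` up to an arbitrary error. -/
lemma eventually_integral_norm_sq_le {Y : Type*} [MeasurableSpace Y] (σ : Measure Y)
    [IsFiniteMeasure σ] {E : Set Y} (hE : MeasurableSet E) (a : ℕ → Y → ℂ)
    (ha : ∀ N, Measurable (a N)) (ha1 : ∀ N y, ‖a N y‖ ≤ 1) {η : ℝ}
    (hsmall : ∀ y ∉ E, ∀ᶠ N in atTop, ‖a N y‖ ≤ η) {ε : ℝ} (hε : 0 < ε) :
    ∀ᶠ N in atTop, ∫ y, ‖a N y‖ ^ 2 ∂σ ≤ σ.real E + η ^ 2 * σ.real Set.univ + ε := by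
  have hbd : ∀ N y, ‖a N y‖ ^ 2 ≤ 1 := fun N y => pow_le_one₀ (norm_nonneg _) (ha1 N y)
  have hint : ∀ N, Integrable (fun y => ‖a N y‖ ^ 2) σ := fun N =>
    Integrable.of_bound ((ha N).norm.pow_const 2).aestronglyMeasurable 1
      (Eventually.of_forall fun y => by
        rw [Real.norm_of_nonneg (by positivity)]; exact hbd N y)
  have hmeas : ∀ N, AEStronglyMeasurable (fun y => max (‖a N y‖ ^ 2) (η ^ 2)) (σ.restrict Eᶜ) :=
    fun N => (((ha N).norm.pow_const 2).max measurable_const).aestronglyMeasurable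
  have hle : ∀ N y, ‖max (‖a N y‖ ^ 2) (η ^ 2)‖ ≤ max 1 (η ^ 2) := fun N y => by
    rw [Real.norm_of_nonneg (le_max_of_le_right (by positivity))]
    exact max_le_max (hbd N y) le_rfl
  have hlim : Tendsto (fun N => ∫ y in Eᶜ, max (‖a N y‖ ^ 2) (η ^ 2) ∂σ) atTop
      (nhds (∫ _ in Eᶜ, η ^ 2 ∂σ)) := by
    refine tendsto_integral_of_dominated_convergence (fun _ => max 1 (η ^ 2)) hmeas
      (integrable_const _) (fun N => Eventually.of_forall (hle N)) ?_
    filter_upwards [ae_restrict_mem hE.compl] with y hy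
    refine tendsto_const_nhds.congr' ?_
    filter_upwards [hsmall y hy] with N hN
    exact (max_eq_right (pow_le_pow_left₀ (norm_nonneg _) hN 2)).symm
  have hlt : ∫ _ in Eᶜ, η ^ 2 ∂σ < η ^ 2 * σ.real Set.univ + ε := by
    rw [setIntegral_const, smul_eq_mul, mul_comm]
    have : σ.real Eᶜ ≤ σ.real Set.univ := measureReal_mono (Set.subset_univ _)
    have := mul_le_mul_of_nonneg_left this (sq_nonneg η)
    linarith
  filter_upwards [hlim.eventually_lt_const hlt] with N hN
  rw [← integral_add_compl hE (hint N)]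
  have h1 : ∫ y in E, ‖a N y‖ ^ 2 ∂σ ≤ σ.real E := by
    calc _ ≤ ∫ _ in E, (1 : ℝ) ∂σ :=
          integral_mono (hint N).integrableOn (integrable_const _) (hbd N)
      _ = σ.real E := by simp
  have h2 : ∫ y in Eᶜ, ‖a N y‖ ^ 2 ∂σ ≤ ∫ y in Eᶜ, max (‖a N y‖ ^ 2) (η ^ 2) ∂σ :=
    integral_mono (hint N).integrableOn
      (Integrable.of_bound (hmeas N) _ (Eventually.of_forall (hle N))) fun y => le_max_left _ _
  linarith

/-- **Polynomial dichotomy.** Let `δ, ε > 0` and let `P = (P₁, …, P_d) : ℤ^r → ℤ^d` be an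
integer polynomial map with zero constant term whose components are linearly independent
over `ℚ`. There is a positive integer `M = M(δ, ε, P)` such that: if `T` is an ergodic
measure-preserving `ℤ^d`-action on a probability space `(X, μ)`, `A` is measurable with
`μ(A) ≥ δ` and spectral measure `σ`, and `σ(Rat(M)) < μ(A)²ε²/4`, then
`μ(⋃_{n ∈ ℤ^r} (T^{P(n)})⁻¹ A) > 1 - ε`. -/
theorem polynomial_dichotomy
    (r d : ℕ) (p : Fin d → MvPolynomial (Fin r) ℤ)
    (hp0 : ∀ i, MvPolynomial.constantCoeff (p i) = 0)
    (hind : LinearIndependent ℚ fun i => (p i).map (Int.castRingHom ℚ))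
    (δ ε : ℝ) (hδ : 0 < δ) (hε : 0 < ε) :
    ∃ M : ℕ, 0 < M ∧
      ∀ (X : Type) (_ : MeasurableSpace X) (μ : Measure X) (_ : IsProbabilityMeasure μ)
        (T : (Fin d → ℤ) → X → X), IsErgodicAction d T μ →
        ∀ A : Set X, MeasurableSet A → δ ≤ (μ A).toReal →
          ∀ σ : Measure (Fin d → AddCircle (1 : ℝ)), IsFiniteMeasure σ →
            IsSpectralMeasure d T μ A σ →
            (σ (ratTorsion d M)).toReal < (μ A).toReal ^ 2 * ε ^ 2 / 4 →
            1 - ε < (μ (⋃ n : Fin r → ℤ,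
              T (fun i => MvPolynomial.eval n (p i)) ⁻¹' A)).toReal := by
  set η : ℝ := √(ε * δ ^ 2 / 4) with hη
  have hη0 : 0 < η := by positivity
  have hη2 : η ^ 2 = ε * δ ^ 2 / 4 := Real.sq_sqrt (by positivity)
  obtain ⟨M, hM, x, hx⟩ := exists_eventually_norm_sum_torusChar_le p hp0 hind hη0
  refine ⟨M, hM, fun X _ μ _ T hT A hA hδA σ _ hσ hrat => ?_⟩
  set P : (Fin r → ℤ) → Fin d → ℤ := fun n i => MvPolynomial.eval n (p i) with hP
  change 1 - ε < (μ (⋃ n : Fin r → ℤ, T (P n) ⁻¹' A)).toReal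
  set U := ⋃ n : Fin r → ℤ, T (P n) ⁻¹' A with hU
  have hUm : MeasurableSet U := MeasurableSet.iUnion fun n => (hT.1.2.2 _).measurable hA
  set a : ℕ → (Fin d → AddCircle (1 : ℝ)) → ℂ := fun N α =>
    ∑ n ∈ Finset.range N, (((N : ℝ)⁻¹ : ℝ) : ℂ) * torusChar (P (x n)) α with ha
  have hanorm : ∀ N α, ‖a N α‖ = (N : ℝ)⁻¹ * ‖∑ n ∈ Finset.range N, torusChar (P (x n)) α‖ := by
    intro N α
    rw [ha]
    simp only
    rw [← Finset.mul_sum, norm_mul, Complex.norm_real, Real.norm_of_nonneg (by positivity)]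
  have hacont : ∀ N, Continuous (a N) := fun N => by
    have := fun n => continuous_torusChar (P (x n))
    rw [ha]; fun_prop
  have ha1 : ∀ N α, ‖a N α‖ ≤ 1 := by
    intro N α
    rw [hanorm]
    have h1 : ‖∑ n ∈ Finset.range N, torusChar (P (x n)) α‖ ≤ N := by
      refine (norm_sum_le _ _).trans ?_
      simp [norm_torusChar]
    exact (mul_le_mul_of_nonneg_left h1 (by positivity)).trans (inv_mul_le_one)
  have hsmall : ∀ α ∉ ({0} ∪ ratTorsion d M : Set (Fin d → AddCircle (1 : ℝ))),
      ∀ᶠ N in atTop, ‖a N α‖ ≤ η := by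
    intro α hα
    simp only [Set.mem_union, Set.mem_singleton_iff, not_or] at hα
    filter_upwards [hx α hα.1 hα.2, eventually_gt_atTop 0] with N hN hN0
    have hN0' : (0 : ℝ) < N := by exact_mod_cast hN0
    rw [hanorm, inv_mul_le_iff₀ hN0', mul_comm]
    exact hN
  have hmass : σ.real Set.univ ≤ 1 := by
    have h1 := hσ 0
    simp only [Pi.zero_apply, zero_smul, Finset.sum_const_zero, AddCircle.toCircle_zero,
      Circle.coe_one, integral_const] at h1
    have h2 : (μ (A ∩ T 0 ⁻¹' A)).toReal = σ.real Set.univ := by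
      apply Complex.ofReal_injective
      rw [h1]; simp
    rw [← h2]
    exact measureReal_le_one
  have hE : σ.real ({0} ∪ ratTorsion d M) ≤ (μ A).toReal ^ 2 + (μ A).toReal ^ 2 * ε ^ 2 / 4 :=
    (measureReal_union_le _ _).trans
      (add_le_add (hT.spectralMeasure_zero_le hA hσ) hrat.le)
  have hev := eventually_integral_norm_sq_le σ
    ((measurableSet_singleton 0).union (measurableSet_ratTorsion d M)) a
    (fun N => (hacont N).measurable) ha1 hsmall (ε := ε * δ ^ 2 / 4) (by positivity)
  obtain ⟨N, hN, hN0⟩ := (hev.and (eventually_gt_atTop 0)).exists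
  have hN0' : (N : ℝ) ≠ 0 := by positivity
  have hnorm := norm_sum_preimageIndicator_sq hT.1 hA hσ (Finset.range N)
    (fun _ => (N : ℝ)⁻¹) (fun n => P (x n))
  set F := ∑ n ∈ Finset.range N, (N : ℝ)⁻¹ • preimageIndicator hT.1 hA (P (x n)) with hF
  set u := indicatorConstLp 2 hUm (measure_ne_top μ U) (1 : ℝ) with hu
  have hinner : inner ℝ u F = (μ A).toReal := by
    rw [hF, inner_sum]
    rw [Finset.sum_congr rfl fun n _ => by
      rw [real_inner_smul_right, inner_indicator_preimageIndicator hT.1 hA hUm (P (x n))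
        (Set.subset_iUnion (fun n => T (P n) ⁻¹' A) (x n))]]
    rw [Finset.sum_const, Finset.card_range, nsmul_eq_mul, mul_inv_cancel_left₀ hN0']
  have hu2 : ‖u‖ ^ 2 = (μ U).toReal := by
    rw [← real_inner_self_eq_norm_sq, hu,
      L2.real_inner_indicatorConstLp_one_indicatorConstLp_one, Set.inter_self, Measure.real]
  have hcs : (μ A).toReal ^ 2 ≤ (μ U).toReal * ‖F‖ ^ 2 := by
    rw [← hu2, ← mul_pow, ← hinner]
    have := abs_real_inner_le_norm u F
    rw [← sq_abs]
    gcongr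
  have hF2 : ‖F‖ ^ 2 ≤ (μ A).toReal ^ 2 + (μ A).toReal ^ 2 * ε ^ 2 / 4 + ε * δ ^ 2 / 2 := by
    rw [hnorm]
    have h1 : η ^ 2 * σ.real Set.univ ≤ η ^ 2 := mul_le_of_le_one_right (sq_nonneg _) hmass
    rw [hη2] at h1 hN
    calc _ ≤ _ := hN
      _ ≤ _ := by linarith
  by_contra hcon
  rw [not_lt] at hcon
  have hm : 0 < (μ A).toReal := hδ.trans_le hδA
  have hU0 : 0 ≤ (μ U).toReal := ENNReal.toReal_nonneg
  have hε1 : ε ≤ 1 := by linarith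
  have hδm : δ ^ 2 ≤ (μ A).toReal ^ 2 := by gcongr
  have hF3 : ‖F‖ ^ 2 ≤ (μ A).toReal ^ 2 * (1 + ε ^ 2 / 4 + ε / 2) := by nlinarith
  have h4 : (μ A).toReal ^ 2 ≤ (μ A).toReal ^ 2 * ((1 - ε) * (1 + ε ^ 2 / 4 + ε / 2)) :=
    calc _ ≤ _ := hcs
      _ ≤ (1 - ε) * ((μ A).toReal ^ 2 * (1 + ε ^ 2 / 4 + ε / 2)) := by gcongr
      _ = _ := by ring
  have h5 : (1 - ε) * (1 + ε ^ 2 / 4 + ε / 2) < 1 := by nlinarith [pow_pos hε 2, pow_pos hε 3]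
  nlinarith [pow_pos hm 2]
end

section
/- Annihilators of short independent vectors are rational of small denominator: Let M be a positive integer and let v₁, …, v_d ∈ ℤ^d be linearly independent vectors (for example, any d distinct elements of a haystack, restricted to H_M) with ‖v_i‖_∞ ≤ (M/d!)^{1/d} for each i. Then every α ∈ 𝕋^d = (ℝ/ℤ)^d satisfying v_i·α = 0 in ℝ/ℤ for all i = 1, …, d is a torsion point of order at most M, i.e. there exists an integer 1 ≤ q ≤ M with qα = 0. -/
open MeasureTheory Filter
open scoped symmDiff

/-- If an integer matrix kills a vector over an additive commutative group, so does its
determinant. -/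
theorem Matrix.det_zsmul_eq_zero_of_forall_sum_zsmul_eq_zero {n G : Type*} [Fintype n]
    [DecidableEq n] [AddCommGroup G] (A : Matrix n n ℤ) (x : n → G)
    (h : ∀ i, ∑ j, A i j • x j = 0) : A.det • x = 0 := by
  funext k
  calc
    A.det • x k = ∑ j, (A.adjugate * A) k j • x j := by
      simp [Matrix.adjugate_mul, Matrix.smul_apply, Matrix.one_apply, ite_smul]
    _ = ∑ i, A.adjugate k i • ∑ j, A i j • x j := by
      simp only [Matrix.mul_apply, Finset.sum_smul, Finset.smul_sum, mul_smul]
      exact Finset.sum_comm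
    _ = 0 := by simp [h]

/-- **Annihilators of short independent vectors are rational of small denominator.**
Let `M` be a positive integer and `v₁, …, v_d ∈ ℤ^d` linearly independent vectors with
`‖v_i‖_∞ ≤ (M/d!)^{1/d}` for each `i`. Then every `α ∈ 𝕋^d = (ℝ/ℤ)^d` with `v_i·α = 0`
in `ℝ/ℤ` for all `i` is a torsion point of order at most `M`. -/
theorem annihilator_of_short_independent_vectors
    (d M : ℕ) (hd : 1 ≤ d) (hM : 0 < M)
    (v : Fin d → (Fin d → ℤ))
    (hind : LinearIndependent ℚ fun i => fun j => ((v i j : ℚ)))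
    (hshort : ∀ i j, ((|v i j| : ℤ) : ℝ) ≤ ((M : ℝ) / (d.factorial : ℝ)) ^ ((1 : ℝ) / (d : ℝ)))
    (α : Fin d → AddCircle (1 : ℝ))
    (hα : ∀ i, ∑ j, (v i j) • (α j) = 0) :
    ∃ q : ℕ, 1 ≤ q ∧ q ≤ M ∧ q • α = 0 := by
  let A : Matrix (Fin d) (Fin d) ℤ := Matrix.of v
  have hdet : A.det ≠ 0 := by
    have hunit := Matrix.linearIndependent_rows_iff_isUnit.mp
      (show LinearIndependent ℚ (A.map (Int.cast : ℤ → ℚ)).row from hind)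
    rw [Matrix.isUnit_iff_isUnit_det, isUnit_iff_ne_zero, ← Int.cast_det] at hunit
    exact_mod_cast hunit
  have hle : A.det.natAbs ≤ M := by
    have hbound := Matrix.det_le (A := A.map (Int.cast : ℤ → ℝ)) (abv := AbsoluteValue.abs)
      (fun i j => by simpa [A] using hshort i j)
    rw [← Int.cast_det, Fintype.card_fin,
      Real.rpow_inv_natCast_pow (by positivity) (by lia), nsmul_eq_mul,
      mul_div_cancel₀ _ (by positivity), AbsoluteValue.abs_apply] at hbound
    have : (A.det.natAbs : ℝ) ≤ M := by rwa [Nat.cast_natAbs, Int.cast_abs]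
    exact_mod_cast this
  refine ⟨A.det.natAbs, Int.natAbs_pos.mpr hdet, hle, ?_⟩
  rw [natAbs_nsmul_eq_zero]
  exact A.det_zsmul_eq_zero_of_forall_sum_zsmul_eq_zero α hα
end

section
/- Infinitely many primes with small polynomial image: For every polynomial P with integer coefficients in one variable with deg P ≥ 2 there exists a real constant λ ∈ (0,1) such that there are infinitely many primes p for which the image V(P, p) = {P(n) mod p : n ∈ ℤ} of P in ℤ/pℤ satisfies |V(P, p)| ≤ λp. -/
open MeasureTheory Filter
open scoped symmDiff

/-- Over a finite field with `q` elements, the values of a polynomial of degree less than `q - 1`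
sum to zero. -/
theorem sum_eval_eq_zero_of_natDegree_lt {F : Type*} [Field F] [Fintype F]
    (g : Polynomial F) (hg : g.natDegree < Fintype.card F - 1) :
    ∑ x : F, g.eval x = 0 := by
  simp_rw [Polynomial.eval_eq_sum_range]
  rw [Finset.sum_comm]
  refine Finset.sum_eq_zero fun i hi => ?_
  rw [← Finset.mul_sum, FiniteField.sum_pow_lt_card_sub_one F i, mul_zero]
  have := Finset.mem_range.mp hi
  omega

/-- For a self-map of a finite type, there are at most as many values attained more than once
as values not attained at all. -/
theorem card_repeated_le_card_missing {α : Type*} [Fintype α] [DecidableEq α] (f : α → α) :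
    (Finset.univ.filter fun v => 2 ≤ (Finset.univ.filter fun x => f x = v).card).card ≤
      (Finset.univ.filter fun v => (Finset.univ.filter fun x => f x = v).card = 0).card := by
  have hsum : ∑ v : α, (Finset.univ.filter fun x => f x = v).card = ∑ _v : α, 1 := by
    rw [← Finset.card_eq_sum_card_fiberwise (fun x _ => Finset.mem_univ (f x))]
    simp
  rw [Finset.card_filter, Finset.card_filter]
  have hle : ∑ v : α, (1 + if 2 ≤ (Finset.univ.filter fun x => f x = v).card then 1 else 0) ≤
      ∑ v : α, ((Finset.univ.filter fun x => f x = v).card +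
        if (Finset.univ.filter fun x => f x = v).card = 0 then 1 else 0) := by
    refine Finset.sum_le_sum fun v _ => ?_
    split_ifs <;> omega
  rw [Finset.sum_add_distrib, Finset.sum_add_distrib, hsum] at hle
  omega

/-- A polynomial of degree at most `d` that does not permute a finite field with `q` elements
misses at least `(q - 1) / (2 d)` values. -/
theorem card_sub_one_le_of_not_injective_eval {F : Type*} [Field F] [Fintype F] [DecidableEq F]
    (f : Polynomial F) {d : ℕ} (hd : 0 < d) (hfd : f.natDegree ≤ d)
    (hf : ¬ Function.Injective fun x => f.eval x) :
    Fintype.card F - 1 ≤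
      2 * (Finset.univ.filter fun v =>
        (Finset.univ.filter fun x => f.eval x = v).card = 0).card * d := by
  have hrep := card_repeated_le_card_missing fun x => f.eval x
  by_contra! hlt
  set N : F → ℕ := fun v => (Finset.univ.filter fun x => f.eval x = v).card with hN
  set M := Finset.univ.filter fun v => N v = 0 with hM
  set B := Finset.univ.filter fun v => 2 ≤ N v with hB
  obtain ⟨v₀, hv₀⟩ : ∃ v₀, N v₀ = 0 := by
    rw [Finite.injective_iff_surjective, Function.Surjective] at hf
    push Not at hf
    obtain ⟨v, hv⟩ := hf
    exact ⟨v, by simpa [hN, Finset.filter_eq_empty_iff] using hv⟩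
  set S := (M ∪ B).erase v₀ with hS
  set g : Polynomial F := ∏ v ∈ S, (Polynomial.X - Polynomial.C v) with hg
  have hgdeg : g.natDegree ≤ 2 * M.card := by
    rw [hg, Polynomial.natDegree_finsetProd_X_sub_C_eq_card, hS]
    have h1 := Finset.card_erase_le (s := M ∪ B) (a := v₀)
    have h2 := Finset.card_union_le M B
    omega
  have hgS : ∀ v ∈ S, g.eval v = 0 := by
    intro v hv
    rw [hg, Polynomial.eval_prod]
    exact Finset.prod_eq_zero hv (by simp)
  have hg₀ : g.eval v₀ ≠ 0 := by
    rw [hg, Polynomial.eval_prod, Finset.prod_ne_zero_iff]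
    intro v hv
    rw [Polynomial.eval_sub, Polynomial.eval_X, Polynomial.eval_C, sub_ne_zero]
    exact (Finset.ne_of_mem_erase hv).symm
  have hsum : ∑ v : F, g.eval v = 0 := by
    refine sum_eval_eq_zero_of_natDegree_lt g ?_
    nlinarith
  have hsumf : ∑ v : F, (N v : F) * g.eval v = 0 := by
    have hcomp : ∑ x : F, (g.comp f).eval x = 0 := by
      refine sum_eval_eq_zero_of_natDegree_lt _ (lt_of_le_of_lt ?_ hlt)
      rw [Polynomial.natDegree_comp]
      exact Nat.mul_le_mul hgdeg hfd
    rw [← hcomp, ← Finset.sum_fiberwise Finset.univ (fun x => f.eval x)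
      fun x => (g.comp f).eval x]
    refine Finset.sum_congr rfl fun v _ => ?_
    rw [← nsmul_eq_mul]
    refine (Finset.sum_eq_card_nsmul fun x hx => ?_).symm
    rw [Polynomial.eval_comp, (Finset.mem_filter.mp hx).2]
  have hdiff : ∑ v : F, ((N v : F) - 1) * g.eval v = 0 := by
    simp_rw [sub_mul, one_mul]
    rw [Finset.sum_sub_distrib, hsum, hsumf, sub_zero]
  rw [Finset.sum_eq_single v₀] at hdiff
  · simp [hv₀, hg₀] at hdiff
  · intro v _ hv
    by_cases h1 : N v = 1
    · simp [h1]
    · rw [hgS v, mul_zero]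
      rw [hS, Finset.mem_erase, Finset.mem_union, hM, hB, Finset.mem_filter, Finset.mem_filter]
      refine ⟨hv, ?_⟩
      have : N v = 0 ∨ 2 ≤ N v := by omega
      simpa using this
  · simp

/-- If `R` is a nonconstant integer polynomial and `R(a) ≠ 0`, there are arbitrarily large
primes `p ∤ R(a)` modulo which `R` has a root. -/
theorem exists_large_prime_dvd_eval (R : Polynomial ℤ) (hR : 0 < R.natDegree) (a : ℤ)
    (ha : R.eval a ≠ 0) (N : ℕ) :
    ∃ p : ℕ, N ≤ p ∧ p.Prime ∧ ¬ (p : ℤ) ∣ R.eval a ∧ ∃ x : ℤ, (p : ℤ) ∣ R.eval x := by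
  set c := R.eval a with hc
  set m : ℤ := c * (N.factorial : ℤ) with hm
  have hm0 : m ≠ 0 := mul_ne_zero ha (by exact_mod_cast N.factorial_ne_zero)
  set L : Polynomial ℤ := Polynomial.C (c * m) * Polynomial.X + Polynomial.C a with hL
  have hLdeg : L.natDegree = 1 := Polynomial.natDegree_linear (mul_ne_zero ha hm0)
  have hQ : 0 < (R.comp L).natDegree := by
    rw [Polynomial.natDegree_comp, hLdeg]
    omega
  have hne : ∀ b : ℤ, R.comp L - Polynomial.C b ≠ 0 := by
    intro b hb
    rw [sub_eq_zero] at hb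
    simp [hb] at hQ
  obtain ⟨t, ht⟩ : ∃ t : ℤ,
      ((R.comp L - Polynomial.C c) * (R.comp L - Polynomial.C (-c))).eval t ≠ 0 := by
    by_contra! h
    exact mul_ne_zero (hne c) (hne (-c)) (Polynomial.funext fun t => by simpa using h t)
  set x := L.eval t with hx
  have hxa : x - a = c * m * t := by simp [hx, hL]
  simp only [Polynomial.eval_mul, Polynomial.eval_sub, Polynomial.eval_comp, Polynomial.eval_C,
    ← hx] at ht
  obtain ⟨s, hs⟩ := Polynomial.sub_dvd_eval_sub x a R
  have hfac : R.eval x = c * (1 + m * (t * s)) := by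
    rw [hxa, ← hc] at hs
    linear_combination hs
  have hunit : (1 + m * (t * s)).natAbs ≠ 1 := by
    intro h
    rcases Int.natAbs_eq_iff.mp h with h | h <;> rw [h] at hfac <;> simp [hfac] at ht
  obtain ⟨p, hp, hpd⟩ := Nat.exists_prime_and_dvd hunit
  rw [← Int.natCast_dvd] at hpd
  have hpm : ¬ (p : ℤ) ∣ m := by
    intro h
    have h1 : (p : ℤ) ∣ 1 := (Int.dvd_add_left (h.mul_right _)).mp hpd
    exact hp.one_lt.ne' (by exact_mod_cast Int.eq_one_of_dvd_one (by positivity) h1)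
  refine ⟨p, ?_, hp, fun h => hpm (h.mul_right _), x, hfac ▸ hpd.mul_left _⟩
  by_contra! hlt
  exact hpm (Dvd.dvd.mul_left (by exact_mod_cast hp.dvd_factorial.mpr hlt.le) _)

/-- An integer polynomial of degree at least two is non-injective modulo arbitrarily large
primes. -/
theorem exists_large_prime_not_injective_eval (P : Polynomial ℤ) (hdeg : 2 ≤ P.natDegree)
    (N : ℕ) :
    ∃ p : ℕ, N ≤ p ∧ p.Prime ∧
      ¬ Function.Injective fun n : ZMod p => (P.map (Int.castRingHom (ZMod p))).eval n := by
  have hder : P.derivative ≠ 0 := by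
    intro h
    have := Polynomial.derivative_eq_zero.mp h
    omega
  obtain ⟨a, ha⟩ : ∃ a : ℤ, P.derivative.eval a ≠ 0 := by
    by_contra! h
    exact hder (Polynomial.funext fun t => by simpa using h t)
  obtain ⟨R, hPR⟩ : Polynomial.X - Polynomial.C a ∣ P - Polynomial.C (P.eval a) :=
    Polynomial.X_sub_C_dvd_sub_C_eval
  have hRa : R.eval a = P.derivative.eval a := by
    have := congrArg (fun q => (Polynomial.derivative q).eval a) hPR
    simpa using this.symm
  have hR : 0 < R.natDegree := by
    have hR0 : R ≠ 0 := by
      rintro rfl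
      simp at hRa
      exact ha hRa.symm
    have h := congrArg Polynomial.natDegree hPR
    rw [Polynomial.natDegree_sub_C, Polynomial.natDegree_mul (Polynomial.X_sub_C_ne_zero a) hR0,
      Polynomial.natDegree_X_sub_C] at h
    omega
  obtain ⟨p, hNp, hp, hpa, x, hx⟩ := exists_large_prime_dvd_eval R hR a (hRa ▸ ha) N
  refine ⟨p, hNp, hp, fun hinj => hpa ?_⟩
  have hPx : P.eval x - P.eval a = (x - a) * R.eval x := by
    simpa using congrArg (Polynomial.eval x) hPR
  have hxa : ((x : ℤ) : ZMod p) = ((a : ℤ) : ZMod p) := by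
    apply hinj
    simp only [Polynomial.eval_intCast_map, eq_intCast]
    rw [← sub_eq_zero, ← Int.cast_sub, ZMod.intCast_zmod_eq_zero_iff_dvd, Int.cast_id, Int.cast_id,
      hPx]
    exact hx.mul_left _
  rw [← sub_eq_zero, ← Int.cast_sub, ZMod.intCast_zmod_eq_zero_iff_dvd] at hxa
  exact (Int.dvd_iff_dvd_of_dvd_sub (hxa.trans (Polynomial.sub_dvd_eval_sub x a R))).mp hx


/-- **Infinitely many primes with small polynomial image.** For every polynomial
`P ∈ ℤ[n]` with `deg P ≥ 2` there is a constant `λ ∈ (0,1)` such that there are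
infinitely many primes `p` for which the image `V(P, p) = {P(n) mod p : n ∈ ℤ}`
satisfies `|V(P, p)| ≤ λp`. -/
theorem infinitely_many_primes_with_small_polynomial_image
    (P : Polynomial ℤ) (hdeg : 2 ≤ P.natDegree) :
    ∃ lam : ℝ, 0 < lam ∧ lam < 1 ∧
      ∀ N : ℕ, ∃ p : ℕ, N ≤ p ∧ p.Prime ∧
        (((Set.range fun n : ZMod p =>
          Polynomial.eval n (P.map (Int.castRingHom (ZMod p)))).ncard : ℝ))
            ≤ lam * (p : ℝ) := by
  have hd : (2 : ℝ) ≤ P.natDegree := by exact_mod_cast hdeg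
  have hinv : 1 / (4 * (P.natDegree : ℝ)) ≤ 1 / 8 :=
    one_div_le_one_div_of_le (by norm_num) (by linarith)
  have hpos : 0 < 1 / (4 * (P.natDegree : ℝ)) := by positivity
  refine ⟨1 - 1 / (4 * (P.natDegree : ℝ)), by linarith, by linarith, fun N => ?_⟩
  obtain ⟨p, hNp, hp, hinj⟩ := exists_large_prime_not_injective_eval P hdeg N
  refine ⟨p, hNp, hp, ?_⟩
  have : Fact p.Prime := ⟨hp⟩
  set f := P.map (Int.castRingHom (ZMod p)) with hf
  have hmiss := card_sub_one_le_of_not_injective_eval f (d := P.natDegree) (by omega)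
    Polynomial.natDegree_map_le hinj
  have hcompl : (Finset.univ.filter fun v : ZMod p =>
      (Finset.univ.filter fun x => f.eval x = v).card = 0) =
      (Finset.univ.image fun x => f.eval x)ᶜ := by
    ext v
    simp [Finset.filter_eq_empty_iff]
  have hcard := Finset.card_add_card_compl (Finset.univ.image fun x : ZMod p => f.eval x)
  rw [hcompl] at hmiss
  have hrange : (Set.range fun n : ZMod p => f.eval n).ncard =
      (Finset.univ.image fun x : ZMod p => f.eval x).card := by
    rw [← Set.ncard_coe_finset]
    simp
  rw [hrange]
  rw [ZMod.card] at hmiss hcard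
  set m := ((Finset.univ.image fun x : ZMod p => f.eval x)ᶜ).card
  have hmR : (p : ℝ) ≤ 4 * P.natDegree * m := by
    have h2 := hp.two_le
    have h : p ≤ 2 * (2 * m * P.natDegree) := by omega
    have hR : (p : ℝ) ≤ 2 * (2 * m * P.natDegree) := by exact_mod_cast h
    linarith
  have hcardR : ((Finset.univ.image fun x : ZMod p => f.eval x).card : ℝ) + m = p := by
    exact_mod_cast hcard
  have hdiv : 1 / (4 * (P.natDegree : ℝ)) * p ≤ m := by
    rw [one_div_mul_eq_div, div_le_iff₀ (by positivity)]
    linarith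
  linarith
end

section
/- Failure of full directional expansivity: For every integer d ≥ 2 there exist a probability space (X, μ), a totally ergodic measure-preserving ℤ^d-action T on (X, μ) (i.e., for every positive integer k the restricted kℤ^d-action (T^{kv})_{v∈ℤ^d} is ergodic with respect to μ), and a measurable set A ⊆ X with μ(A) > 0 such that for every vector v ∈ ℤ^d one has μ(⋃_{n∈ℤ} (T^{nv})⁻¹A) < 1. -/
open MeasureTheory Filter
open scoped symmDiff

/-- Ergodicity of the restricted `kℤ^d`-action `(T (k•v))_{v ∈ ℤ^d}` with respect to `ν`. -/
def SubActionErgodic {X : Type} [MeasurableSpace X] (d k : ℕ)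
    (T : (Fin d → ℤ) → X → X) (ν : Measure X) : Prop :=
  ∀ B : Set X, MeasurableSet B →
    (∀ v : Fin d → ℤ, ν ((T ((k : ℤ) • v) ⁻¹' B) ∆ B) = 0) → ν B = 0 ∨ ν B = 1

/-- A `T^k`-ergodic component of `μ`: a normalized restriction `ν = μ(· ∩ C)/μ(C)` to a
`kℤ^d`-invariant (mod null sets) set `C` of positive measure such that the restricted
`kℤ^d`-action is ergodic with respect to `ν`. -/
def IsErgodicComponent {X : Type} [MeasurableSpace X] (d k : ℕ)
    (T : (Fin d → ℤ) → X → X) (μ ν : Measure X) : Prop :=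
  ∃ C : Set X, MeasurableSet C ∧ 0 < μ C ∧
    (∀ v : Fin d → ℤ, μ ((T ((k : ℤ) • v) ⁻¹' C) ∆ C) = 0) ∧
    ν = (μ C)⁻¹ • μ.restrict C ∧
    SubActionErgodic d k T ν
lemma abs_measureReal_sub_le_measureReal_symmDiff {X : Type*} [MeasurableSpace X] (μ : Measure X)
    [IsFiniteMeasure μ] (s t : Set X) : |μ.real s - μ.real t| ≤ μ.real (s ∆ t) := by
  have key : ∀ a b : Set X, μ.real a ≤ μ.real b + μ.real (a ∆ b) := fun a b =>
    (measureReal_mono (fun x hx => by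
      by_cases hb : x ∈ b
      · exact Or.inl hb
      · exact Or.inr (Or.inl ⟨hx, hb⟩))).trans (measureReal_union_le _ _)
  have h1 := key s t
  have h2 := key t s
  rw [symmDiff_comm] at h2
  rw [abs_le]
  constructor <;> linarith

/-- Under a product measure, a cylinder over `F` is independent of its preimage under a
reindexing moving `F` off itself. -/
lemma measureReal_cylinder_inter_preimage {ι Y : Type*} [DecidableEq ι] [MeasurableSpace Y]
    (P : Measure Y) [IsProbabilityMeasure P] (F : Finset ι) {S : Set (F → Y)}
    (hS : MeasurableSet S) {f : ι → ι} (hf : Function.Injective f)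
    (hdisj : Disjoint F (F.image f)) :
    (Measure.infinitePi fun _ : ι => P).real
        (cylinder F S ∩ (fun x i => x (f i)) ⁻¹' cylinder F S) =
      (Measure.infinitePi fun _ : ι => P).real (cylinder F S) ^ 2 := by
  set μ := Measure.infinitePi fun _ : ι => P
  have hmp : MeasurePreserving (fun (x : ι → Y) i => x (f i)) μ μ :=
    ⟨by fun_prop, Measure.map_infinitePi_infinitePi_of_inj (P := fun _ => P) hf⟩
  have hind : ProbabilityTheory.iIndepFun (fun (i : ι) (x : ι → Y) => x i) μ :=
    ProbabilityTheory.iIndepFun_infinitePi (P := fun _ : ι => P) (X := fun _ y => y)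
      (fun _ => measurable_id)
  have hFG := hind.indepFun_finset F (F.image f) hdisj (fun i => measurable_pi_apply i)
  let φ : (F.image f → Y) → F → Y := fun z s => z ⟨f s, Finset.mem_image_of_mem f s.2⟩
  have hφ : Measurable φ := by fun_prop
  have h := hFG.measure_inter_preimage_eq_mul S (φ ⁻¹' S) hS (hφ hS)
  have hpre := hmp.measure_preimage (MeasurableSet.cylinder F hS).nullMeasurableSet
  have h' : μ (cylinder F S ∩ (fun x i => x (f i)) ⁻¹' cylinder F S) =
      μ (cylinder F S) * μ ((fun x i => x (f i)) ⁻¹' cylinder F S) := h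
  rw [hpre] at h'
  rw [measureReal_def, h', ENNReal.toReal_mul, sq, measureReal_def]

/-- A zero-one law: a set which is almost invariant under reindexings moving any given finite
set of coordinates off itself is trivial for the product measure. -/
lemma infinitePi_eq_zero_or_one_of_reindex_invariant {ι Y : Type*} [DecidableEq ι]
    [MeasurableSpace Y] (P : Measure Y) [IsProbabilityMeasure P] {B : Set (ι → Y)}
    (hB : MeasurableSet B)
    (h : ∀ F : Finset ι, ∃ f : ι → ι, Function.Injective f ∧ Disjoint F (F.image f) ∧
      (Measure.infinitePi fun _ : ι => P) (((fun x i => x (f i)) ⁻¹' B) ∆ B) = 0) :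
    (Measure.infinitePi fun _ : ι => P) B = 0 ∨ (Measure.infinitePi fun _ : ι => P) B = 1 := by
  set μ := Measure.infinitePi fun _ : ι => P with hμ
  have key : ∀ ε : ℝ, 0 < ε → |μ.real B - μ.real B ^ 2| ≤ 4 * ε := by
    intro ε hε
    obtain ⟨C, hC, hCB⟩ := exists_measure_symmDiff_lt_of_generateFrom_isSetRing (μ := μ)
      (C := measurableCylinders fun _ : ι => Y) isSetAlgebra_measurableCylinders.isSetRing
      ⟨{Set.univ}, Set.countable_singleton _,
        Set.singleton_subset_iff.2 (univ_mem_measurableCylinders _), by simp⟩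
      generateFrom_measurableCylinders.symm hB (ENNReal.ofReal_pos.2 hε)
    have hCm := MeasurableSet.of_mem_measurableCylinders hC
    obtain ⟨F, S, hS, rfl⟩ := (mem_measurableCylinders C).1 hC
    obtain ⟨f, hf, hdisj, hinv⟩ := h F
    have hCB' : μ.real (cylinder F S ∆ B) ≤ ε := by
      rw [measureReal_def]
      exact ENNReal.toReal_le_of_le_ofReal hε.le hCB.le
    have hmp : MeasurePreserving (fun (x : ι → Y) i => x (f i)) μ μ :=
      ⟨by fun_prop, Measure.map_infinitePi_infinitePi_of_inj (P := fun _ => P) hf⟩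
    have hpre : μ.real ((fun (x : ι → Y) i => x (f i)) ⁻¹' (cylinder F S ∆ B)) ≤ ε := by
      rwa [measureReal_def, hmp.measure_preimage (hCm.symmDiff hB).nullMeasurableSet]
    have hinv' : μ.real (((fun (x : ι → Y) i => x (f i)) ⁻¹' B) ∆ B) = 0 := by
      simp [measureReal_def, hinv]
    have hsq := measureReal_cylinder_inter_preimage P F hS hf hdisj
    rw [← hμ] at hsq
    have hsub : B ∆ (cylinder F S ∩ (fun x i => x (f i)) ⁻¹' cylinder F S) ⊆
        cylinder F S ∆ B ∪ ((fun (x : ι → Y) i => x (f i)) ⁻¹' (cylinder F S ∆ B) ∪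
          ((fun (x : ι → Y) i => x (f i)) ⁻¹' B) ∆ B) := by
      intro x
      simp only [Set.mem_symmDiff, Set.mem_union, Set.mem_inter_iff, Set.mem_preimage]
      tauto
    have h2 : μ.real (B ∆ (cylinder F S ∩ (fun x i => x (f i)) ⁻¹' cylinder F S)) ≤ 2 * ε := by
      have h3 := (measureReal_mono (μ := μ) hsub).trans (measureReal_union_le _ _)
      have h4 := measureReal_union_le (μ := μ)
        ((fun (x : ι → Y) i => x (f i)) ⁻¹' (cylinder F S ∆ B))
        (((fun (x : ι → Y) i => x (f i)) ⁻¹' B) ∆ B)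
      linarith
    have h5 := (abs_measureReal_sub_le_measureReal_symmDiff μ _ _).trans h2
    rw [hsq] at h5
    have h6 := (abs_measureReal_sub_le_measureReal_symmDiff μ _ _).trans hCB'
    have hc0 : 0 ≤ μ.real (cylinder F S) := measureReal_nonneg
    have hc1 : μ.real (cylinder F S) ≤ 1 := measureReal_le_one
    have hb0 : 0 ≤ μ.real B := measureReal_nonneg
    have hb1 : μ.real B ≤ 1 := measureReal_le_one
    rw [abs_le] at h5 h6 ⊢
    constructor <;> nlinarith
  have h0 : μ.real B - μ.real B ^ 2 = 0 := by
    by_contra hne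
    have hpos := abs_pos.2 hne
    have := key (|μ.real B - μ.real B ^ 2| / 8) (by positivity)
    linarith
  have h1 : μ.real B * (1 - μ.real B) = 0 := by linarith
  rcases mul_eq_zero.1 h1 with h2 | h2
  · left
    simpa [measureReal_def, ENNReal.toReal_eq_zero_iff] using h2
  · right
    have h3 : (μ B).toReal = 1 := by rw [measureReal_def] at h2; linarith
    exact (ENNReal.toReal_eq_one_iff _).1 h3

/-- There are integer linear forms `L v` on `ℤ^d`, `d ≥ 2`, with `L v v = 0`, such that finitely
many of them never have kernels covering `ℤ^d`. -/
lemma exists_linearForms_vanishing (d : ℕ) (hd : 2 ≤ d) :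
    ∃ L : (Fin d → ℤ) → (Fin d → ℤ) →+ ℤ, (∀ v, L v v = 0) ∧
      ∀ I : Finset (Fin d → ℤ), ∃ w, ∀ v ∈ I, L v w ≠ 0 := by
  let a : Fin d := ⟨0, by omega⟩
  let b : Fin d := ⟨1, by omega⟩
  have hab : b ≠ a := by simp [a, b]
  let L : (Fin d → ℤ) → (Fin d → ℤ) →+ ℤ := fun v =>
    if v a = 0 then Pi.evalAddMonoidHom _ a
    else v b • Pi.evalAddMonoidHom _ a - v a • Pi.evalAddMonoidHom _ b
  refine ⟨L, fun v => ?_, fun I => ?_⟩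
  · by_cases hv : v a = 0
    · simp [L, hv]
    · simp [L, hv, mul_comm]
  · let t : ℤ := 1 + ∑ v ∈ I, |v b|
    refine ⟨Function.update (fun _ => t) a 1, fun v hv => ?_⟩
    by_cases hva : v a = 0
    · simp [L, hva]
    · have hle : |v b| ≤ ∑ v ∈ I, |v b| :=
        Finset.single_le_sum (f := fun v : Fin d → ℤ => |v b|) (fun _ _ => abs_nonneg _) hv
      simp only [L, hva, if_false, AddMonoidHom.sub_apply, AddMonoidHom.smul_apply,
        Pi.evalAddMonoidHom_apply, Function.update_self, Function.update_of_ne hab, smul_eq_mul,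
        mul_one]
      intro h0
      have h1 : |v b| = |v a| * t := by
        rw [sub_eq_zero.1 h0, abs_mul, abs_of_nonneg (a := t) (by positivity)]
      have h2 : 1 ≤ |v a| := Int.one_le_abs hva
      have h3 : |v b| < t := by simp only [t]; linarith
      have h4 : 0 ≤ |v b| := abs_nonneg _
      nlinarith

/-- Shifting the `v`-th row of `S × ℤ` by `L v w`. -/
def rowShift {S G : Type*} [AddCommMonoid G] (L : S → G →+ ℤ) (w : G) (s : S × ℤ) : S × ℤ :=
  (s.1, s.2 + L s.1 w)

lemma rowShift_injective {S G : Type*} [AddCommMonoid G] (L : S → G →+ ℤ) (w : G) :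
    Function.Injective (rowShift L w) := by
  rintro ⟨s, m⟩ ⟨s', m'⟩ h
  obtain ⟨rfl, h⟩ := Prod.mk.inj h
  simpa using h

lemma exists_disjoint_image_rowShift {S G : Type*} [DecidableEq S] [AddCommGroup G]
    (L : S → G →+ ℤ) (hL : ∀ I : Finset S, ∃ w, ∀ v ∈ I, L v w ≠ 0) {k : ℕ} (hk : 0 < k)
    (F : Finset (S × ℤ)) : ∃ w, Disjoint F (F.image (rowShift L ((k : ℤ) • w))) := by
  obtain ⟨w, hw⟩ := hL (F.image Prod.fst)
  let N : ℤ := 1 + 2 * ∑ s ∈ F, |s.2|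
  have hN : 0 < N := by positivity
  refine ⟨N • w, Finset.disjoint_left.2 ?_⟩
  rintro s hs hs'
  obtain ⟨r, hr, rfl⟩ := Finset.mem_image.1 hs'
  have hle : ∀ q ∈ F, |q.2| ≤ ∑ s ∈ F, |s.2| := fun q hq =>
    Finset.single_le_sum (f := fun s : S × ℤ => |s.2|) (fun _ _ => abs_nonneg _) hq
  have h1 := hle _ hs
  have h2 := hle _ hr
  simp only [rowShift, map_zsmul, smul_eq_mul] at h1
  have h3 : 1 ≤ |L r.1 w| := Int.one_le_abs (hw _ (Finset.mem_image_of_mem _ hr))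
  have h4 : |(k : ℤ) * (N * L r.1 w)| ≤ 2 * ∑ s ∈ F, |s.2| := by
    have := abs_sub (r.2 + (k : ℤ) * (N * L r.1 w)) r.2
    rw [add_sub_cancel_left] at this
    linarith
  rw [abs_mul, abs_mul, abs_of_pos hN, Nat.abs_cast] at h4
  have hk' : (1 : ℤ) ≤ k := by exact_mod_cast hk
  have h5 : N ≤ N * |L r.1 w| := le_mul_of_one_le_right hN.le h3
  have h6 : N * |L r.1 w| ≤ k * (N * |L r.1 w|) :=
    le_mul_of_one_le_left (hN.le.trans h5) hk'
  simp only [N] at *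
  linarith

/-- **Failure of full directional expansivity.** For every `d ≥ 2` there are a probability
space `(X, μ)`, a totally ergodic measure-preserving `ℤ^d`-action `T` on `(X, μ)` (for
every positive integer `k` the restricted `kℤ^d`-action is ergodic with respect to `μ`)
and a measurable set `A` with `μ(A) > 0` such that for every `v ∈ ℤ^d` one has
`μ(⋃_{n ∈ ℤ} (T^{nv})⁻¹ A) < 1`. -/
theorem failure_of_full_directional_expansivity (d : ℕ) (hd : 2 ≤ d) :
    ∃ (X : Type) (_ : MeasurableSpace X) (μ : Measure X) (_ : IsProbabilityMeasure μ)
      (T : (Fin d → ℤ) → X → X),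
      IsMPAction d T μ ∧
      (∀ k : ℕ, 0 < k → SubActionErgodic d k T μ) ∧
      ∃ A : Set X, MeasurableSet A ∧ 0 < μ A ∧
        ∀ v : Fin d → ℤ, μ (⋃ n : ℤ, T (n • v) ⁻¹' A) < 1 := by
  classical
  obtain ⟨L, hLv, hL⟩ := exists_linearForms_vanishing d hd
  set P : Measure unitInterval := volume with hP
  set μ := Measure.infinitePi fun _ : (Fin d → ℤ) × ℤ => P with hμ
  obtain ⟨ε, hε, hsum⟩ := ENNReal.exists_pos_sum_of_countable' one_ne_zero (Fin d → ℤ)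
  have hε1 : ∀ v, ε v ≤ 1 := fun v => (ENNReal.le_tsum v).trans hsum.le
  let δ : (Fin d → ℤ) → unitInterval := fun v =>
    ⟨(ε v).toReal, ENNReal.toReal_nonneg, ENNReal.toReal_le_of_le_ofReal zero_le_one (by
      simpa using hε1 v)⟩
  have hδ : ∀ v, μ {x | x (v, 0) ≤ δ v} = ε v := fun v => by
    have h := (measurePreserving_eval_infinitePi (fun _ : (Fin d → ℤ) × ℤ => P)
      (v, 0)).measure_preimage (s := Set.Iic (δ v)) measurableSet_Iic.nullMeasurableSet
    rw [hP, unitInterval.volume_Iic] at h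
    exact h.trans (ENNReal.ofReal_toReal ((hε1 v).trans_lt ENNReal.one_lt_top).ne)
  have hmeas : ∀ v, MeasurableSet {x : (Fin d → ℤ) × ℤ → unitInterval | x (v, 0) ≤ δ v} :=
    fun v => measurableSet_le (measurable_pi_apply _) measurable_const
  have hprob : IsProbabilityMeasure μ := by rw [hμ]; infer_instance
  refine ⟨(Fin d → ℤ) × ℤ → unitInterval, inferInstance, μ, hprob,
    fun w x s => x (rowShift L w s), ⟨?_, ?_, ?_⟩, ?_, (⋃ v, {x | x (v, 0) ≤ δ v})ᶜ, ?_, ?_, ?_⟩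
  · funext x s
    simp [rowShift]
  · intro v w
    funext x s
    simp [rowShift, add_assoc]
  · exact fun w => ⟨by fun_prop, Measure.map_infinitePi_infinitePi_of_inj (P := fun _ => P)
      (rowShift_injective L w)⟩
  · intro k hk B hB hinv
    refine infinitePi_eq_zero_or_one_of_reindex_invariant P hB fun F => ?_
    obtain ⟨w, hw⟩ := exists_disjoint_image_rowShift L hL hk F
    exact ⟨_, rowShift_injective L _, hw, hinv w⟩
  · exact (MeasurableSet.iUnion hmeas).compl
  · rw [pos_iff_ne_zero, ne_eq, prob_compl_eq_zero_iff (MeasurableSet.iUnion hmeas)]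
    exact (((measure_iUnion_le _).trans_eq (tsum_congr hδ)).trans_lt hsum).ne
  · intro v
    refine lt_of_le_of_lt (measure_mono (t := {x | x (v, 0) ≤ δ v}ᶜ) ?_) ?_
    · refine Set.iUnion_subset fun n x hx hxv => hx (Set.mem_iUnion.2 ⟨v, ?_⟩)
      have h0 : L v (n • v) = 0 := by rw [map_zsmul, hLv, smul_zero]
      simpa only [Set.mem_preimage, Set.mem_ofPred_eq, rowShift, h0, add_zero] using hxv
    · refine lt_of_le_of_ne prob_le_one fun h => ?_
      rw [prob_compl_eq_one_iff (hmeas v), hδ] at h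
      exact (hε v).ne' h
end

section
/- Directional orbit measure bounded below by spectral mass: Let T be an ergodic measure-preserving ℤ^d-action on a probability space (X, μ), let A ⊆ X be measurable with μ(A) > 0, and let σ be the spectral measure of A. Then for every v ∈ ℤ^d one has μ(⋃_{n∈ℤ} (T^{nv})⁻¹A) ≥ μ(A)²/σ(L_v^⊥). (Note σ(L_v^⊥) ≥ σ({0}) = μ(A)² > 0, so the right-hand side is well-defined.) -/
open MeasureTheory Filter
open scoped symmDiff

/-- The Cesàro averages of the powers of a point of the unit circle converge in norm to `1` at
the point `1` and to `0` elsewhere. -/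
theorem tendsto_norm_sq_cesaro_pow_circle (z : Circle) :
    Tendsto (fun N : ℕ => ‖(∑ n ∈ Finset.range N, (z : ℂ) ^ n)‖ ^ 2 / (N : ℝ) ^ 2) atTop
      (nhds (Set.indicator {1} (fun _ => (1 : ℝ)) z)) := by
  by_cases hz : z = 1
  · subst hz
    refine tendsto_const_nhds.congr' ?_
    filter_upwards [eventually_gt_atTop 0] with N hN
    have : (N : ℝ) ≠ 0 := by positivity
    simp [this]
  · have hz' : (z : ℂ) - 1 ≠ 0 := by
      intro h
      exact hz (Circle.ext (by simpa [sub_eq_zero] using h))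
    rw [Set.indicator_of_notMem (by simpa using hz)]
    have hlim : Tendsto (fun N : ℕ => (2 / ‖(z : ℂ) - 1‖ / (N : ℝ)) ^ 2) atTop (nhds 0) := by
      simpa using (tendsto_const_div_atTop_nhds_zero_nat (2 / ‖(z : ℂ) - 1‖)).pow 2
    refine squeeze_zero (fun N => by positivity) (fun N => ?_) hlim
    rw [← div_pow]
    gcongr
    rw [geom_sum_eq (by simpa [sub_eq_zero] using hz'), norm_div]
    gcongr
    calc ‖(z : ℂ) ^ N - 1‖ ≤ ‖(z : ℂ) ^ N‖ + ‖(1 : ℂ)‖ := norm_sub_le _ _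
      _ = 2 := by rw [norm_pow, Circle.norm_coe]; norm_num

/-- The squared modulus of a geometric sum on the unit circle, as a double sum. -/
theorem norm_sq_sum_pow_circle (z : Circle) (N : ℕ) :
    ((‖(∑ n ∈ Finset.range N, (z : ℂ) ^ n)‖ ^ 2 : ℝ) : ℂ) =
      ∑ m ∈ Finset.range N, ∑ n ∈ Finset.range N, ((z ^ ((n : ℤ) - m) : Circle) : ℂ) := by
  rw [Complex.ofReal_pow, ← Complex.conj_mul', map_sum, Finset.sum_mul_sum]
  refine Finset.sum_congr rfl fun m _ => Finset.sum_congr rfl fun n _ => ?_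
  rw [map_pow, ← Circle.coe_inv_eq_conj, sub_eq_neg_add, zpow_add]
  simp

/-- The pairwise correlations of the translates of `A` along an action depend only on the
difference of the translations. -/
theorem IsMPAction.measure_preimage_inter_preimage
    {X : Type} [MeasurableSpace X] {d : ℕ} {μ : Measure X}
    {T : (Fin d → ℤ) → X → X} (hT : IsMPAction d T μ) {A : Set X} (hA : MeasurableSet A)
    (v w : Fin d → ℤ) :
    μ (T v ⁻¹' A ∩ T w ⁻¹' A) = μ (A ∩ T (w - v) ⁻¹' A) := by
  have h : T v ⁻¹' A ∩ T w ⁻¹' A = T v ⁻¹' (A ∩ T (w - v) ⁻¹' A) := by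
    rw [Set.preimage_inter, ← Set.preimage_comp, ← hT.2.1, sub_add_cancel]
  rw [h, (hT.2.2 v).measure_preimage
    (hA.inter ((hT.2.2 _).measurable hA)).nullMeasurableSet]

/-- A second-moment lower bound for the measure of a union of sets of equal measure. -/
theorem sq_measureReal_mul_le_measureReal_iUnion_mul
    {X ι : Type*} [MeasurableSpace X] [Countable ι] (μ : Measure X) [IsFiniteMeasure μ]
    (P : ι → Set X) (hP : ∀ i, MeasurableSet (P i)) (s : Finset ι) :
    (∑ i ∈ s, μ.real (P i)) ^ 2 ≤
      μ.real (⋃ i, P i) * ∑ i ∈ s, ∑ j ∈ s, μ.real (P i ∩ P j) := by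
  set B := ⋃ i, P i with hB
  have hBm : MeasurableSet B := MeasurableSet.iUnion hP
  have key (t : ℝ) : 2 * t * (∑ i ∈ s, μ.real (P i)) - t ^ 2 * μ.real B ≤
      ∑ i ∈ s, ∑ j ∈ s, μ.real (P i ∩ P j) := by
    have hint (S : Set X) (hS : MeasurableSet S) :
        Integrable (S.indicator (1 : X → ℝ)) μ :=
      (integrable_const (1 : ℝ)).indicator hS
    have e1 : ∑ i ∈ s, ∑ j ∈ s, μ.real (P i ∩ P j) =
        ∫ x, ∑ i ∈ s, ∑ j ∈ s, (P i ∩ P j).indicator (1 : X → ℝ) x ∂μ := by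
      rw [integral_finsetSum _ fun i _ => integrable_finsetSum _ fun j _ =>
        hint _ ((hP i).inter (hP j))]
      refine Finset.sum_congr rfl fun i _ => ?_
      rw [integral_finsetSum _ fun j _ => hint _ ((hP i).inter (hP j))]
      exact Finset.sum_congr rfl fun j _ => (integral_indicator_one ((hP i).inter (hP j))).symm
    have e2 : 2 * t * (∑ i ∈ s, μ.real (P i)) - t ^ 2 * μ.real B =
        ∫ x, (2 * t * (∑ i ∈ s, (P i).indicator (1 : X → ℝ) x) -
          t ^ 2 * B.indicator (1 : X → ℝ) x) ∂μ := by
      rw [integral_sub ((integrable_finsetSum _ fun i _ => hint _ (hP i)).const_mul _)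
        ((hint _ hBm).const_mul _), integral_const_mul, integral_const_mul,
        integral_finsetSum _ fun i _ => hint _ (hP i), integral_indicator_one hBm]
      congr 2
      exact Finset.sum_congr rfl fun i _ => (integral_indicator_one (hP i)).symm
    rw [e1, e2]
    refine integral_mono
      (((integrable_finsetSum _ fun i _ => hint _ (hP i)).const_mul _).sub
        ((hint _ hBm).const_mul _))
      (integrable_finsetSum _ fun i _ => integrable_finsetSum _ fun j _ =>
        hint _ ((hP i).inter (hP j))) fun x => ?_
    simp only [Set.inter_indicator_one, Pi.mul_apply]
    rw [← Finset.sum_mul_sum]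
    by_cases hx : x ∈ B
    · rw [Set.indicator_of_mem hx, Pi.one_apply]
      nlinarith [sq_nonneg ((∑ i ∈ s, (P i).indicator (1 : X → ℝ) x) - t)]
    · have h0 : ∑ i ∈ s, (P i).indicator (1 : X → ℝ) x = 0 :=
        Finset.sum_eq_zero fun i _ =>
          Set.indicator_of_notMem (fun h => hx (Set.mem_iUnion.2 ⟨i, h⟩)) _
      simp [h0, hx]
  rcases eq_or_lt_of_le (measureReal_nonneg (μ := μ) (s := B)) with h0 | hpos
  · have hz : ∑ i ∈ s, μ.real (P i) = 0 := Finset.sum_eq_zero fun i _ =>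
      le_antisymm (h0 ▸ measureReal_mono (Set.subset_iUnion P i)) measureReal_nonneg
    simp [hz, ← h0]
  · have h := mul_le_mul_of_nonneg_left (key ((∑ i ∈ s, μ.real (P i)) / μ.real B)) hpos.le
    refine le_trans (le_of_eq ?_) h
    field_simp
    ring

/-- The mean-square averages of the characters `α ↦ e(n v·α)` converge to the `σ`-mass of the
annihilator of `v`. -/
theorem tendsto_integral_norm_sq_cesaro_character {d : ℕ}
    (σ : Measure (Fin d → AddCircle (1 : ℝ))) [IsFiniteMeasure σ] (v : Fin d → ℤ) :
    Tendsto (fun N : ℕ => ∫ α, ‖(∑ n ∈ Finset.range N,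
        (AddCircle.toCircle (∑ i, v i • α i) : ℂ) ^ n)‖ ^ 2 / (N : ℝ) ^ 2 ∂σ) atTop
      (nhds (σ.real {α | ∑ i, v i • α i = 0})) := by
  have hc : Continuous fun α : Fin d → AddCircle (1 : ℝ) => ∑ i, v i • α i := by fun_prop
  have hL : MeasurableSet {α : Fin d → AddCircle (1 : ℝ) | ∑ i, v i • α i = 0} :=
    (isClosed_singleton.preimage hc).measurableSet
  rw [← integral_indicator_one hL]
  refine tendsto_integral_of_dominated_convergence (fun _ => 1) (fun N => ?_)
    (integrable_const _) (fun N => ae_of_all _ fun α => ?_) (ae_of_all _ fun α => ?_)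
  · have hz : Continuous fun α : Fin d → AddCircle (1 : ℝ) =>
        (AddCircle.toCircle (∑ i, v i • α i) : ℂ) :=
      continuous_induced_dom.comp (AddCircle.continuous_toCircle.comp hc)
    exact Continuous.aestronglyMeasurable (by fun_prop)
  · rw [Real.norm_of_nonneg (by positivity), ← div_pow]
    refine pow_le_one₀ (by positivity) (div_le_one_of_le₀ ?_ (by positivity))
    exact (norm_sum_le _ _).trans (by simp [norm_pow, Circle.norm_coe])
  · convert tendsto_norm_sq_cesaro_pow_circle (AddCircle.toCircle (∑ i, v i • α i)) using 2
    have hiff : AddCircle.toCircle (∑ i, v i • α i) = 1 ↔ ∑ i, v i • α i = 0 := by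
      rw [← AddCircle.toCircle_zero (T := 1)]
      exact (AddCircle.injective_toCircle one_ne_zero).eq_iff
    have hmem : α ∈ {α : Fin d → AddCircle (1 : ℝ) | ∑ i, v i • α i = 0} ↔
        AddCircle.toCircle (∑ i, v i • α i) ∈ ({1} : Set Circle) := by
      rw [Set.mem_singleton_iff, hiff, Set.mem_ofPred_eq]
    by_cases h : α ∈ {α : Fin d → AddCircle (1 : ℝ) | ∑ i, v i • α i = 0}
    · rw [Set.indicator_of_mem h, Set.indicator_of_mem (hmem.1 h), Pi.one_apply]
    · rw [Set.indicator_of_notMem h, Set.indicator_of_notMem fun hm => h (hmem.2 hm)]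

/-- Correlations of the translates of `A` in direction `v`, summed over a square, in terms of the
spectral measure. -/
theorem IsSpectralMeasure.sum_correlations_eq
    {X : Type} [MeasurableSpace X] {d : ℕ} {μ : Measure X}
    {T : (Fin d → ℤ) → X → X} {A : Set X}
    {σ : Measure (Fin d → AddCircle (1 : ℝ))} [IsFiniteMeasure σ]
    (hσ : IsSpectralMeasure d T μ A σ) (v : Fin d → ℤ) (N : ℕ) :
    ∑ m ∈ Finset.range N, ∑ n ∈ Finset.range N,
        μ.real (A ∩ T (((n : ℤ) - m) • v) ⁻¹' A) =
      ∫ α, ‖(∑ n ∈ Finset.range N,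
        (AddCircle.toCircle (∑ i, v i • α i) : ℂ) ^ n)‖ ^ 2 ∂σ := by
  have hchar (k : ℤ) (α : Fin d → AddCircle (1 : ℝ)) :
      AddCircle.toCircle (∑ i, (k • v) i • α i) =
        AddCircle.toCircle (∑ i, v i • α i) ^ k := by
    rw [← AddCircle.toCircle_zsmul, Finset.smul_sum]
    simp [mul_smul]
  have hint (k : ℤ) : Integrable (fun α : Fin d → AddCircle (1 : ℝ) =>
      ((AddCircle.toCircle (∑ i, v i • α i) ^ k : Circle) : ℂ)) σ := by
    have hc : Continuous fun α : Fin d → AddCircle (1 : ℝ) => ∑ i, v i • α i := by fun_prop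
    have hz : Continuous fun α : Fin d → AddCircle (1 : ℝ) =>
        ((AddCircle.toCircle (∑ i, v i • α i) ^ k : Circle) : ℂ) :=
      continuous_induced_dom.comp ((AddCircle.continuous_toCircle.comp hc).zpow k)
    exact Integrable.of_bound hz.aestronglyMeasurable 1
      (ae_of_all _ fun α => (Circle.norm_coe _).le)
  apply Complex.ofReal_injective
  rw [← integral_complex_ofReal]
  simp only [norm_sq_sum_pow_circle]
  rw [integral_finsetSum _ fun m _ => integrable_finsetSum _ fun n _ => hint _]
  simp only [Complex.ofReal_sum]
  refine Finset.sum_congr rfl fun m _ => ?_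
  rw [integral_finsetSum _ fun n _ => hint _]
  refine Finset.sum_congr rfl fun n _ => ?_
  have h := hσ (((n : ℤ) - m) • v)
  simp only [hchar] at h
  exact h

/-- **Directional orbit measure bounded below by spectral mass.** Let `T` be an ergodic
measure-preserving `ℤ^d`-action on a probability space `(X, μ)`, `A` measurable with
`μ(A) > 0` and spectral measure `σ`. Then for every `v ∈ ℤ^d` one has
`μ(⋃_{n ∈ ℤ} (T^{nv})⁻¹ A) ≥ μ(A)² / σ(L_v^⊥)`. -/
theorem directional_orbit_lower_bound
    {X : Type} [MeasurableSpace X] (d : ℕ) (μ : Measure X) [IsProbabilityMeasure μ]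
    (T : (Fin d → ℤ) → X → X) (hT : IsErgodicAction d T μ)
    (A : Set X) (hA : MeasurableSet A) (hA0 : 0 < μ A)
    (σ : Measure (Fin d → AddCircle (1 : ℝ))) [IsFiniteMeasure σ]
    (hσ : IsSpectralMeasure d T μ A σ)
    (v : Fin d → ℤ) :
    (μ A).toReal ^ 2 / (σ {α : Fin d → AddCircle (1 : ℝ) | ∑ i, (v i) • (α i) = 0}).toReal
      ≤ (μ (⋃ n : ℤ, T (n • v) ⁻¹' A)).toReal := by
  have hMP := hT.1
  have hP (n : ℤ) : MeasurableSet (T (n • v) ⁻¹' A) := (hMP.2.2 _).measurable hA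
  have hbound (N : ℕ) (hN : 0 < N) : μ.real A ^ 2 ≤ μ.real (⋃ n : ℤ, T (n • v) ⁻¹' A) *
      ∫ α, ‖(∑ n ∈ Finset.range N,
        (AddCircle.toCircle (∑ i, v i • α i) : ℂ) ^ n)‖ ^ 2 / (N : ℝ) ^ 2 ∂σ := by
    have h := sq_measureReal_mul_le_measureReal_iUnion_mul μ (fun n : ℤ => T (n • v) ⁻¹' A) hP
      ((Finset.range N).map Nat.castEmbedding)
    have h1 (n : ℤ) : μ.real (T (n • v) ⁻¹' A) = μ.real A :=
      (hMP.2.2 _).measureReal_preimage hA.nullMeasurableSet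
    have h2 (m n : ℤ) : μ.real (T (m • v) ⁻¹' A ∩ T (n • v) ⁻¹' A) =
        μ.real (A ∩ T ((n - m) • v) ⁻¹' A) := by
      rw [measureReal_def, hMP.measure_preimage_inter_preimage hA, sub_smul, measureReal_def]
    simp only [Finset.sum_map, Nat.castEmbedding_apply, h1, h2, Finset.sum_const,
      Finset.card_map, Finset.card_range, nsmul_eq_mul] at h
    rw [hσ.sum_correlations_eq v N] at h
    rw [integral_div, ← mul_div_assoc, le_div_iff₀ (by positivity)]
    linarith [mul_pow (N : ℝ) (μ.real A) 2]
  have hlim := ge_of_tendsto ((tendsto_integral_norm_sq_cesaro_character σ v).const_mul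
    (μ.real (⋃ n : ℤ, T (n • v) ⁻¹' A)))
    (by filter_upwards [eventually_gt_atTop 0] with N hN using hbound N hN)
  exact div_le_of_le_mul₀ ENNReal.toReal_nonneg ENNReal.toReal_nonneg hlim
end
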